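/- (Right properness of the Kan–Quillen model structure) Given a pullback square of simplicial sets in which p : X → Y is a Kan fibration and f : B → Y is a weak homotopy equivalence, the induced map X ×_Y B → X is a weak homotopy equivalence. -/

import Mathlib

open CategoryTheory CategoryTheory.Limits Simplicial MonoidalCategory SSet

noncomputable instance : MonoidalClosed SSet.{0} :=
  (inferInstance : MonoidalClosed (SimplexCategoryᵒᵖ ⥤ Type 0))

namespace Paper

/-- A map of simplicial sets is a *trivial fibration* if it has the right lifting
property with respect to all boundary inclusions `∂Δ[n] ⟶ Δ[n]` for `n ≥ 0`. -/
def TrivialFibration {X Y : SSet.{0}} (p : X ⟶ Y) : Prop :=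
  ∀ n : ℕ, HasLiftingProperty (SSet.boundary n).ι p

/-- A map of simplicial sets is a *Kan fibration* if it has the right lifting property
with respect to all horn inclusions `Λ[n, i] ⟶ Δ[n]` for `n ≥ 1`, `0 ≤ i ≤ n`. -/
def KanFibration {X Y : SSet.{0}} (p : X ⟶ Y) : Prop :=
  ∀ (n : ℕ) (i : Fin (n + 2)), HasLiftingProperty (SSet.horn (n + 1) i).ι p

/-- An *anodyne* map is one with the left lifting property with respect to
all Kan fibrations. -/
def Anodyne {A B : SSet.{0}} (i : A ⟶ B) : Prop :=
  ∀ ⦃X Y : SSet.{0}⦄ (p : X ⟶ Y), KanFibration p → HasLiftingProperty i p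

/-- The unique map to `Δ[0]`. -/
def toPt (X : SSet.{0}) : X ⟶ Δ[0] where
  app m := ↾fun _ => SSet.stdSimplex.const 0 0 m
  naturality := by
    intro m m' φ
    ext x
    apply stdSimplex.objEquiv.injective
    apply SimplexCategory.Hom.ext
    apply OrderHom.ext
    funext j
    exact @Subsingleton.elim (Fin 1) _ _ _

/-- A *Kan complex* is a simplicial set whose map to `Δ[0]` is a Kan fibration. -/
def KanComplex (X : SSet.{0}) : Prop :=
  KanFibration (toPt X)

/-- The constant map at the vertex `k` of `Δ[1]`. -/
def cst (X : SSet.{0}) (k : Fin 2) : X ⟶ Δ[1] where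
  app m := ↾fun _ => SSet.stdSimplex.const 1 k m
  naturality := by
    intro m m' φ
    ext x
    apply stdSimplex.objEquiv.injective
    apply SimplexCategory.Hom.ext
    ext j
    rfl

/-- The endpoint inclusion `X ⟶ X ⊗ Δ[1]` at the vertex `k` of `Δ[1]`. -/
noncomputable def ept (X : SSet.{0}) (k : Fin 2) : X ⟶ X ⊗ Δ[1] :=
  CartesianMonoidalCategory.lift (𝟙 X) (cst X k)

/-- A (single-step) homotopy from `f` to `g`, as a property of the pair `(f, g)`. -/
def Homotopy {X Y : SSet.{0}} (f g : X ⟶ Y) : Prop :=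
  ∃ H : X ⊗ Δ[1] ⟶ Y, ept X 0 ≫ H = f ∧ ept X 1 ≫ H = g

/-- `f` and `g` are *homotopic* if they are connected by a zig-zag of homotopies. -/
def Homotopic {X Y : SSet.{0}} (f g : X ⟶ Y) : Prop :=
  Relation.EqvGen Homotopy f g

/-- A *homotopy equivalence* of simplicial sets. -/
def HomotopyEquivalence {X Y : SSet.{0}} (f : X ⟶ Y) : Prop :=
  ∃ g : Y ⟶ X, Homotopic (f ≫ g) (𝟙 X) ∧ Homotopic (g ≫ f) (𝟙 Y)

/-- A map `f : X ⟶ Y` is a *weak homotopy equivalence* if for every Kan complex `K`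
the induced map `K^Y ⟶ K^X` on exponentials is a homotopy equivalence. -/
def WeakHomotopyEquivalence {X Y : SSet.{0}} (f : X ⟶ Y) : Prop :=
  ∀ K : SSet.{0}, KanComplex K → HomotopyEquivalence ((MonoidalClosed.pre f).app K)

/-- A homotopy `H` between maps over `B` which is *fiberwise over `B`*. -/
def FibHomotopy {B X Y : SSet.{0}} (pX : X ⟶ B) (pY : Y ⟶ B) (f g : X ⟶ Y) : Prop :=
  ∃ H : X ⊗ Δ[1] ⟶ Y, ept X 0 ≫ H = f ∧ ept X 1 ≫ H = g ∧
    H ≫ pY = CartesianMonoidalCategory.fst X Δ[1] ≫ pX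

/-- Connectedness by a zig-zag of fiberwise homotopies over `B`. -/
def FibHomotopic {B X Y : SSet.{0}} (pX : X ⟶ B) (pY : Y ⟶ B) (f g : X ⟶ Y) : Prop :=
  Relation.EqvGen (FibHomotopy pX pY) f g

/-- A *fiberwise homotopy equivalence over `B`*. -/
def FibHomotopyEquivalence {B X Y : SSet.{0}} (pX : X ⟶ B) (pY : Y ⟶ B) (f : X ⟶ Y) : Prop :=
  f ≫ pY = pX ∧ ∃ g : Y ⟶ X, g ≫ pX = pY ∧
    FibHomotopic pX pX (f ≫ g) (𝟙 X) ∧ FibHomotopic pY pY (g ≫ f) (𝟙 Y)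

end Paper

namespace Paper

theorem app_congr {X Y : SSet.{0}} {f g : X ⟶ Y} (h : f = g) (m : SimplexCategoryᵒᵖ)
    (x : X.obj m) : f.app m x = g.app m x := by
  rw [h]

theorem stdSimplex_ext {n : ℕ} {m : SimplexCategoryᵒᵖ} {x y : (Δ[n] : SSet.{0}).obj m}
    (h : ∀ i, stdSimplex.asOrderHom x i = stdSimplex.asOrderHom y i) : x = y := by
  apply stdSimplex.objEquiv.injective
  apply SimplexCategory.Hom.ext
  ext i
  exact congrArg _ (h i)

theorem kanFibration_iff {X Y : SSet.{0}} (p : X ⟶ Y) :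
    KanFibration p ↔ modelCategoryQuillen.J.{0}.rlp p := by
  constructor
  · intro h A B i hi
    simp only [modelCategoryQuillen.J, MorphismProperty.iSup_iff] at hi
    obtain ⟨n, ⟨i⟩⟩ := hi
    exact h n i
  · intro h n i
    exact h _ (modelCategoryQuillen.horn_ι_mem_J (n + 1) i)

theorem KanFibration.lift {X Y A B : SSet.{0}} {p : X ⟶ Y} (hp : KanFibration p) {i : A ⟶ B}
    (hi : anodyneExtensions i) : HasLiftingProperty i p :=
  hi _ ((kanFibration_iff p).1 hp)

theorem anodyneExtensions_iff {A B : SSet.{0}} (i : A ⟶ B) :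
    anodyneExtensions i ↔
      ∀ ⦃X Y : SSet.{0}⦄ (p : X ⟶ Y), KanFibration p → HasLiftingProperty i p :=
  ⟨fun h _ _ _ hp => hp.lift h, fun h _ _ p hp => h p ((kanFibration_iff p).2 hp)⟩

theorem KanFibration.comp {X Y Z : SSet.{0}} {p : X ⟶ Y} {q : Y ⟶ Z} (hp : KanFibration p)
    (hq : KanFibration q) : KanFibration (p ≫ q) := by
  rw [kanFibration_iff] at *
  exact MorphismProperty.comp_mem _ _ _ hp hq

theorem KanFibration.of_isPullback {X Y Z W : SSet.{0}} {f : X ⟶ Y} {p : X ⟶ Z} {q : Y ⟶ W}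
    {g : Z ⟶ W} (h : IsPullback f p q g) (hq : KanFibration q) : KanFibration p := by
  rw [kanFibration_iff] at *
  exact MorphismProperty.of_isPullback h hq

theorem KanFibration.of_isIso {X Y : SSet.{0}} (p : X ⟶ Y) [IsIso p] : KanFibration p :=
  fun _ _ => inferInstance

theorem KanFibration.of_retract {X Y X' Y' : SSet.{0}} {p : X ⟶ Y} {q : X' ⟶ Y'}
    (h : RetractArrow p q) (hq : KanFibration q) : KanFibration p := by
  rw [kanFibration_iff] at *
  exact MorphismProperty.of_retract h hq

theorem mono_of_anodyneExtensions {A B : SSet.{0}} {i : A ⟶ B} (hi : anodyneExtensions i) :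
    Mono i := by
  have h : anodyneExtensions.{0} ≤ MorphismProperty.monomorphisms SSet := by
    rw [anodyneExtensions_eq_retracts_transfiniteCompositions]
    refine (MorphismProperty.retracts_monotone
      ((MorphismProperty.transfiniteCompositions_monotone
        (MorphismProperty.pushouts_monotone
          (MorphismProperty.coproducts_monotone
            modelCategoryQuillen.J_le_monomorphisms))))).trans ?_
    refine (MorphismProperty.retracts_monotone
      ((MorphismProperty.transfiniteCompositions_monotone
        ((MorphismProperty.pushouts_monotone
          (MorphismProperty.coproducts_le _)).trans
            MorphismProperty.pushouts_le)).trans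
          (MorphismProperty.transfiniteCompositions_le _))).trans ?_
    exact MorphismProperty.retracts_le _
  exact h _ hi

theorem TrivialFibration.lift {X Y A B : SSet.{0}} {p : X ⟶ Y} (hp : TrivialFibration p)
    (i : A ⟶ B) [Mono i] : HasLiftingProperty i p := by
  have h : (MorphismProperty.monomorphisms SSet.{0}).rlp p := by
    rw [rlp_monomorphisms]
    rintro _ _ _ ⟨n⟩
    exact hp n
  exact h i inferInstance

theorem TrivialFibration.kanFibration {X Y : SSet.{0}} {p : X ⟶ Y} (hp : TrivialFibration p) :
    KanFibration p :=
  fun _ _ => hp.lift _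

theorem trivialFibration_of_lift {X Y : SSet.{0}} {p : X ⟶ Y}
    (h : ∀ ⦃A B : SSet.{0}⦄ (i : A ⟶ B) [Mono i], HasLiftingProperty i p) : TrivialFibration p :=
  fun _ => h _

theorem TrivialFibration.of_isPullback {X Y Z W : SSet.{0}} {f : X ⟶ Y} {p : X ⟶ Z} {q : Y ⟶ W}
    {g : Z ⟶ W} (h : IsPullback f p q g) (hq : TrivialFibration q) : TrivialFibration p := by
  intro n
  have := hq n
  exact h.hasLiftingProperty _

theorem exists_anodyne_kan_factorization {X Y : SSet.{0}} (f : X ⟶ Y) :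
    ∃ (Z : SSet.{0}) (i : X ⟶ Z) (p : Z ⟶ Y), anodyneExtensions i ∧ KanFibration p ∧
      i ≫ p = f := by
  let F := MorphismProperty.factorizationData modelCategoryQuillen.J.{0}.rlp.llp
    modelCategoryQuillen.J.{0}.rlp f
  exact ⟨F.Z, F.i, F.p, F.hi, (kanFibration_iff _).2 F.hp, F.fac⟩

theorem ept_fst (X : SSet.{0}) (k : Fin 2) :
    ept X k ≫ SemiCartesianMonoidalCategory.fst X Δ[1] = 𝟙 X :=
  CartesianMonoidalCategory.lift_fst _ _

theorem ept_whiskerRight {X Y : SSet.{0}} (f : X ⟶ Y) (k : Fin 2) :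
    ept X k ≫ f ▷ Δ[1] = f ≫ ept Y k := rfl

theorem anodyneExtensions_cst (k : Fin 2) : anodyneExtensions (cst Δ[0] k) := by
  have hmem : ∀ {m : SimplexCategoryᵒᵖ} (x : (Δ[1] : SSet.{0}).obj m),
      x ∈ (horn.{0} 1 k).obj m ↔ x = stdSimplex.const 1 k m := by
    intro m x
    rw [mem_horn_iff]
    constructor
    · intro h
      apply stdSimplex_ext
      intro i
      change _ = k
      by_contra hi
      apply h
      rw [Set.eq_univ_iff_forall]
      intro j
      by_cases hj : j = k
      · exact Or.inr hj
      · exact Or.inl ⟨i, by lia⟩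
    · rintro rfl h
      have h2 : ∀ j : Fin 2, j = k := fun j => by
        rcases h.ge (Set.mem_univ j) with ⟨i, hi⟩ | h
        · exact hi.symm
        · exact h
      have := (h2 0).trans (h2 1).symm
      simp at this
  let s : Δ[0] ⟶ (horn.{0} 1 k : SSet.{0}) :=
    Subcomplex.lift (cst Δ[0] k) (by
      rintro m _ ⟨x, rfl⟩
      exact (hmem _).2 rfl)
  have hs : s ≫ (horn.{0} 1 k).ι = cst Δ[0] k := rfl
  have hr : toPt _ ≫ cst Δ[0] k = (horn.{0} 1 k).ι := by
    ext m ⟨x, hx⟩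
    exact ((hmem x).1 hx).symm
  let e : (horn.{0} 1 k : SSet.{0}) ≅ Δ[0] :=
    { hom := toPt _
      inv := s
      hom_inv_id := by
        rw [← cancel_mono (horn.{0} 1 k).ι, Category.assoc, hs, hr, Category.id_comp]
      inv_hom_id := stdSimplex.ext₀ }
  refine (anodyneExtensions.arrow_mk_iso_iff ?_).1 (anodyneExtensions.horn_ι k)
  exact Arrow.isoMk e (Iso.refl _) (by simpa [e] using hr)

/-- Lifting of a homotopy relative to a map, in terms of the pushout product. -/
theorem exists_lift_pushoutProduct {S T U V E Y : SSet.{0}} (m : S ⟶ T) (e : U ⟶ V)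
    (h : (Mono m ∧ anodyneExtensions e) ∨ (anodyneExtensions m ∧ Mono e)) {q : E ⟶ Y}
    (hq : KanFibration q) (a : T ⊗ U ⟶ E) (b : S ⊗ V ⟶ E) (H : T ⊗ V ⟶ Y)
    (hab : m ▷ U ≫ a = S ◁ e ≫ b) (ha : T ◁ e ≫ H = a ≫ q) (hb : m ▷ V ≫ H = b ≫ q) :
    ∃ L : T ⊗ V ⟶ E, T ◁ e ≫ L = a ∧ m ▷ V ≫ L = b ∧ L ≫ q = H := by
  let sq := Functor.PushoutObjObj.ofHasPushout (curriedTensor SSet.{0}) m e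
  have hι : anodyneExtensions sq.ι := by
    rcases h with ⟨_, h⟩ | ⟨h, _⟩
    · exact anodyneExtensions_pushoutObjObjι sq h
    · exact anodyneExtensions_pushoutObjObjι' sq h
  have hinl : sq.inl ≫ sq.ι = T ◁ e := sq.inl_ι
  have hinr : sq.inr ≫ sq.ι = m ▷ V := sq.inr_ι
  let d : sq.pt ⟶ E := sq.isPushout.desc a b hab
  have hda : sq.inl ≫ d = a := sq.isPushout.inl_desc _ _ _
  have hdb : sq.inr ≫ d = b := sq.isPushout.inr_desc _ _ _
  have hsq : CommSq d sq.ι q H := by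
    constructor
    apply sq.isPushout.hom_ext
    · rw [reassoc_of% hda, reassoc_of% hinl, ha]
    · rw [reassoc_of% hdb, reassoc_of% hinr, hb]
  have := hq.lift hι
  refine ⟨hsq.lift, ?_, ?_, hsq.fac_right⟩
  · rw [← hinl, Category.assoc, hsq.fac_left, hda]
  · rw [← hinr, Category.assoc, hsq.fac_left, hdb]

/-- The relative homotopy lifting property of Kan fibrations. -/
theorem exists_homotopy_lift {S T E Y : SSet.{0}} (m : S ⟶ T) [Mono m] {q : E ⟶ Y}
    (hq : KanFibration q) (k : Fin 2) (b : T ⟶ E) (h : S ⊗ Δ[1] ⟶ E) (H : T ⊗ Δ[1] ⟶ Y)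
    (hb : m ≫ b = ept S k ≫ h) (hbq : b ≫ q = ept T k ≫ H) (hh : h ≫ q = m ▷ Δ[1] ≫ H) :
    ∃ L : T ⊗ Δ[1] ⟶ E, ept T k ≫ L = b ∧ m ▷ Δ[1] ≫ L = h ∧ L ≫ q = H := by
  have key : ∀ X : SSet.{0}, X ◁ cst Δ[0] k =
      SemiCartesianMonoidalCategory.fst X Δ[0] ≫ ept X k := fun X => rfl
  obtain ⟨L, h1, h2, h3⟩ := exists_lift_pushoutProduct m (cst Δ[0] k)
    (.inl ⟨inferInstance, anodyneExtensions_cst k⟩) hq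
    (SemiCartesianMonoidalCategory.fst T Δ[0] ≫ b) h H
    (by rw [key, Category.assoc, ← hb]; rfl) (by rw [key, Category.assoc, ← hbq]; rfl) hh.symm
  refine ⟨L, ?_, h2, h3⟩
  have e1 : CartesianMonoidalCategory.lift (𝟙 T) (toPt T) ≫ T ◁ cst Δ[0] k = ept T k := rfl
  rw [← e1, Category.assoc, h1, CartesianMonoidalCategory.lift_fst_assoc, Category.id_comp]

/-- The simplicial set with two (degenerate) connected components. -/
def twoPts : SSet.{0} := (Functor.const _).obj (Fin 2)

/-- The inclusion of the two endpoints of the interval. -/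
def twoPtsι : twoPts ⟶ Δ[1] where
  app m := ↾fun k => SSet.stdSimplex.const 1 k m
  naturality := by
    intro m m' φ
    ext x
    apply stdSimplex.objEquiv.injective
    apply SimplexCategory.Hom.ext
    ext j
    rfl

instance : Mono twoPtsι := by
  rw [NatTrans.mono_iff_mono_app]
  intro m
  rw [mono_iff_injective]
  intro (a : Fin 2) (b : Fin 2) (hab : stdSimplex.const 1 a m = stdSimplex.const 1 b m)
  exact congrArg (fun z => stdSimplex.asOrderHom z 0) hab

/-- The map out of `B ⊗ twoPts` given by two maps. -/
def twoPtsDesc {B E : SSet.{0}} (f : Fin 2 → (B ⟶ E)) : B ⊗ twoPts ⟶ E where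
  app m := ↾fun x => (f x.2).app m x.1
  naturality := by
    intro m m' φ
    ext x
    exact NatTrans.naturality_apply (f x.2) φ x.1

theorem exists_homotopy_lift_rel_ends {A B E Y : SSet.{0}} {j : A ⟶ B}
    (hj : anodyneExtensions j) {q : E ⟶ Y} (hq : KanFibration q) (f₀ f₁ : B ⟶ E)
    (h : A ⊗ Δ[1] ⟶ E) (H : B ⊗ Δ[1] ⟶ Y) (h₀ : j ≫ f₀ = ept A 0 ≫ h)
    (h₁ : j ≫ f₁ = ept A 1 ≫ h) (hf₀ : f₀ ≫ q = ept B 0 ≫ H) (hf₁ : f₁ ≫ q = ept B 1 ≫ H)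
    (hh : h ≫ q = j ▷ Δ[1] ≫ H) :
    ∃ L : B ⊗ Δ[1] ⟶ E, ept B 0 ≫ L = f₀ ∧ ept B 1 ≫ L = f₁ ∧ j ▷ Δ[1] ≫ L = h ∧
      L ≫ q = H := by
  have ext2 : ∀ {X Z : SSet.{0}} {u v : X ⊗ twoPts ⟶ Z},
      (∀ m (x : X.obj m) (k : Fin 2), u.app m (x, k) = v.app m (x, k)) → u = v := by
    intro X Z u v H
    ext m ⟨x, k⟩
    exact H m x k
  obtain ⟨L, h1, h2, h3⟩ := exists_lift_pushoutProduct j twoPtsι (.inr ⟨hj, inferInstance⟩) hq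
    (twoPtsDesc ![f₀, f₁]) h H
    (by
      apply ext2
      intro m x k
      fin_cases k
      · exact app_congr h₀ m x
      · exact app_congr h₁ m x)
    (by
      apply ext2
      intro m x k
      fin_cases k
      · exact app_congr hf₀.symm m x
      · exact app_congr hf₁.symm m x)
    hh.symm
  refine ⟨L, ?_, ?_, h2, h3⟩
  · ext m x
    exact app_congr h1 m (x, (0 : Fin 2))
  · ext m x
    exact app_congr h1 m (x, (1 : Fin 2))

theorem isPullback_iff_app {A B C D : SSet.{0}} {t : A ⟶ B} {l : A ⟶ C} {r : B ⟶ D} {b : C ⟶ D} :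
    IsPullback t l r b ↔ t ≫ r = l ≫ b ∧
      (∀ m (x y : A.obj m), t.app m x = t.app m y → l.app m x = l.app m y → x = y) ∧
      ∀ m (x : B.obj m) (y : C.obj m), r.app m x = b.app m y →
        ∃ z : A.obj m, t.app m z = x ∧ l.app m z = y := by
  constructor
  · intro h
    have h' := fun m => (Types.isPullback_iff _ _ _ _).1 (h.app m)
    exact ⟨h.w, fun m x y h1 h2 => (h' m).2.1 x y ⟨h1, h2⟩, fun m => (h' m).2.2⟩
  · rintro ⟨h1, h2, h3⟩
    refine IsPullback.of_forall_isPullback_app fun m => ?_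
    rw [Types.isPullback_iff]
    exact ⟨by rw [← NatTrans.comp_app, h1, NatTrans.comp_app],
      fun x y h => h2 m x y h.1 h.2, h3 m⟩

/-- The simplices of the pushforward of `q : E ⟶ X` along `p : X ⟶ Y`. -/
structure PushforwardObj {X Y E : SSet.{0}} (p : X ⟶ Y) (q : E ⟶ X) (n : SimplexCategoryᵒᵖ) where
  /-- the underlying simplex of the base -/
  y : Y.obj n
  /-- the section over the pullback of `p` along this simplex -/
  s : ∀ (m : SimplexCategoryᵒᵖ) (φ : n ⟶ m) (x : X.obj m), p.app m x = Y.map φ y → E.obj m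
  s_over : ∀ (m : SimplexCategoryᵒᵖ) (φ : n ⟶ m) (x : X.obj m) (h : p.app m x = Y.map φ y),
    q.app m (s m φ x h) = x
  s_natural : ∀ (m m' : SimplexCategoryᵒᵖ) (φ : n ⟶ m) (ψ : m ⟶ m') (x : X.obj m)
    (h : p.app m x = Y.map φ y) (h' : p.app m' (X.map ψ x) = Y.map (φ ≫ ψ) y),
    E.map ψ (s m φ x h) = s m' (φ ≫ ψ) (X.map ψ x) h'

section Pushforward

variable {X Y E : SSet.{0}} (p : X ⟶ Y) (q : E ⟶ X)

variable {p q} in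
theorem PushforwardObj.ext' {n : SimplexCategoryᵒᵖ} {a b : PushforwardObj p q n} (hy : a.y = b.y)
    (hs : ∀ m φ x h h', a.s m φ x h = b.s m φ x h') : a = b := by
  obtain ⟨y, s, _, _⟩ := a
  obtain ⟨y', s', _, _⟩ := b
  obtain rfl : y = y' := hy
  obtain rfl : s = s' := by
    funext m φ x h
    exact hs m φ x h h
  rfl

variable {p q} in
theorem PushforwardObj.s_congr {n m : SimplexCategoryᵒᵖ} {a b : PushforwardObj p q n}
    {φ ψ : n ⟶ m} {x x' : X.obj m} (hab : a = b) (hφ : φ = ψ) (hx : x = x')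
    (h : p.app m x = Y.map φ a.y) (h' : p.app m x' = Y.map ψ b.y) :
    a.s m φ x h = b.s m ψ x' h' := by
  subst hab hφ hx
  rfl

/-- The restriction maps of the pushforward. -/
def PushforwardObj.map {n n' : SimplexCategoryᵒᵖ} (ψ : n ⟶ n') (a : PushforwardObj p q n) :
    PushforwardObj p q n' where
  y := Y.map ψ a.y
  s m φ x h := a.s m (ψ ≫ φ) x (by rw [h, Functor.map_comp]; rfl)
  s_over m φ x h := a.s_over _ _ _ _
  s_natural m m' φ χ x h h' := by
    rw [a.s_natural _ _ _ _ _ _ (by rw [h']; simp)]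
    exact s_congr rfl (Category.assoc _ _ _) rfl _ _

/-- The pushforward of `q : E ⟶ X` along `p : X ⟶ Y`. -/
def pushforward : SSet.{0} where
  obj n := PushforwardObj p q n
  map ψ := ↾(PushforwardObj.map p q ψ)
  map_id n := by
    ext a
    apply PushforwardObj.ext'
    · exact Functor.map_id_apply Y n a.y
    · intros
      exact PushforwardObj.s_congr rfl (Category.id_comp _) rfl _ _
  map_comp φ ψ := by
    ext a
    apply PushforwardObj.ext'
    · exact Functor.map_comp_apply Y φ ψ a.y
    · intros
      exact PushforwardObj.s_congr rfl (Category.assoc _ _ _) rfl _ _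

/-- The structure map of the pushforward. -/
def pushforwardπ : pushforward p q ⟶ Y where
  app _ := ↾fun a => a.y
  naturality _ _ _ := rfl

variable {p q}

/-- A map to the pushforward gives a map out of the pullback. -/
def pushforwardEval {T T' : SSet.{0}} {g : T' ⟶ T} {h : T' ⟶ X} (u : T ⟶ pushforward p q)
    (w : h ≫ p = g ≫ u ≫ pushforwardπ p q) : T' ⟶ E where
  app m := ↾fun z => PushforwardObj.s (u.app m (g.app m z)) m (𝟙 m) (h.app m z) (by
    rw [Functor.map_id_apply]
    exact app_congr w m z)
  naturality m m' φ := by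
    ext z
    refine Eq.trans ?_ (PushforwardObj.s_natural (u.app m (g.app m z)) m m' (𝟙 m) φ
      (h.app m z) _ ?_).symm
    · have h1 : u.app m' (g.app m' (T'.map φ z)) =
          PushforwardObj.map p q φ (u.app m (g.app m z)) := by
        rw [NatTrans.naturality_apply, NatTrans.naturality_apply]
        rfl
      refine (PushforwardObj.s_congr h1 rfl (NatTrans.naturality_apply h φ z) _ ?_).trans
        (PushforwardObj.s_congr rfl
          ((Category.comp_id φ).trans (Category.id_comp φ).symm) rfl _ _)
      rw [Functor.map_id_apply, NatTrans.naturality_apply p]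
      exact congrArg (Y.map φ) (app_congr w m z)
    · rw [NatTrans.naturality_apply p, Category.id_comp]
      exact congrArg (Y.map φ) (app_congr w m z)

theorem pushforwardEval_comp {T T' : SSet.{0}} {g : T' ⟶ T} {h : T' ⟶ X} (u : T ⟶ pushforward p q)
    (w : h ≫ p = g ≫ u ≫ pushforwardπ p q) : pushforwardEval u w ≫ q = h := by
  ext m z
  exact PushforwardObj.s_over _ _ _ _ _

theorem pushforwardEval_eq {T T' S S' : SSet.{0}} {g : T' ⟶ T} {h : T' ⟶ X}
    {u : T ⟶ pushforward p q} {w : h ≫ p = g ≫ u ≫ pushforwardπ p q} {g₁ : S' ⟶ S}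
    {h₁ : S' ⟶ X} {u₁ : S ⟶ pushforward p q} {w₁ : h₁ ≫ p = g₁ ≫ u₁ ≫ pushforwardπ p q}
    (j' : S' ⟶ T') (hg : j' ≫ g ≫ u = g₁ ≫ u₁) (hh : j' ≫ h = h₁) :
    j' ≫ pushforwardEval u w = pushforwardEval u₁ w₁ := by
  ext m z
  exact PushforwardObj.s_congr (app_congr hg m z) rfl (app_congr hh m z) _ _

/-- A map out of the pullback gives a map to the pushforward. -/
theorem exists_pushforward_lift {T T' : SSet.{0}} {g : T' ⟶ T} {h : T' ⟶ X} {t : T ⟶ Y}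
    (sq : IsPullback h g p t) (s : T' ⟶ E) (hs : s ≫ q = h) :
    ∃ (u : T ⟶ pushforward p q) (hu : u ≫ pushforwardπ p q = t),
      pushforwardEval (g := g) (h := h) u (by rw [hu, sq.w]) = s := by
  obtain ⟨-, h2, h3⟩ := isPullback_iff_app.1 sq
  choose w hw1 hw2 using h3
  let u : T ⟶ pushforward p q :=
    { app n := ↾fun a => show PushforwardObj p q n from
        { y := t.app n a
          s m φ x hx := s.app m (w m x (T.map φ a) (by
            rw [hx, NatTrans.naturality_apply t]))
          s_over m φ x hx := (app_congr hs m _).trans (hw1 _ _ _ _)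
          s_natural m m' φ ψ x hx hx' := by
            refine (NatTrans.naturality_apply s ψ _).symm.trans ?_
            congr 1
            apply h2
            · rw [NatTrans.naturality_apply, hw1, hw1]
            · rw [NatTrans.naturality_apply, hw2, hw2, Functor.map_comp_apply] }
      naturality n n' ψ := by
        ext a
        apply PushforwardObj.ext'
        · exact NatTrans.naturality_apply t ψ a
        · intro m φ x hx hx'
          refine congrArg (s.app m) ?_
          apply h2
          · rw [hw1, hw1]
          · rw [hw2, hw2]
            exact (Functor.map_comp_apply T ψ φ a).symm }
  refine ⟨u, rfl, ?_⟩
  ext m z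
  refine congrArg (s.app m) ?_
  apply h2
  · exact hw1 _ _ _ _
  · rw [hw2, Functor.map_id_apply]

theorem pushforward_hom_ext {T T' : SSet.{0}} {g : T' ⟶ T} {h : T' ⟶ X} {t : T ⟶ Y}
    (sq : IsPullback h g p t) {u v : T ⟶ pushforward p q} (hu : u ≫ pushforwardπ p q = t)
    (hv : v ≫ pushforwardπ p q = t)
    (huv : pushforwardEval (g := g) (h := h) u (by rw [hu, sq.w]) =
      pushforwardEval v (by rw [hv, sq.w])) : u = v := by
  obtain ⟨-, -, h3⟩ := isPullback_iff_app.1 sq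
  ext n a
  apply PushforwardObj.ext'
  · exact (app_congr hu n a).trans (app_congr hv n a).symm
  · intro m φ x hx hx'
    obtain ⟨z, hz1, hz2⟩ := h3 m x (T.map φ a) (by
      rw [hx, NatTrans.naturality_apply t]
      exact congrArg (Y.map φ) (app_congr hu n a))
    have key : ∀ (u : T ⟶ pushforward p q) (hu : u ≫ pushforwardπ p q = t) hx,
        PushforwardObj.s (u.app n a) m φ x hx = (pushforwardEval (g := g) (h := h) u
          (by rw [hu, sq.w])).app m z := by
      intro u hu hx
      have h1 : PushforwardObj.map p q φ (u.app n a) = u.app m (g.app m z) := by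
        rw [hz2, NatTrans.naturality_apply]
        rfl
      refine Eq.trans ?_ (PushforwardObj.s_congr h1 rfl hz1.symm ?_ _)
      · exact PushforwardObj.s_congr rfl (by simp) rfl _ _
      · rw [Functor.map_id_apply]
        exact hx
    exact (key u hu hx).trans ((app_congr huv m z).trans (key v hv hx').symm)

end Pushforward

theorem hasLiftingProperty_pushforwardπ {X Y E A B : SSet.{0}} {p : X ⟶ Y} {q : E ⟶ X} {j : A ⟶ B}
    (H : ∀ ⦃A' B' : SSet.{0}⦄ (j' : A' ⟶ B') (a : A' ⟶ A) (b : B' ⟶ B) (x : B' ⟶ X) (t : B ⟶ Y),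
      IsPullback j' a b j → IsPullback x b p t → HasLiftingProperty j' q) :
    HasLiftingProperty j (pushforwardπ p q) where
  sq_hasLift {u t} sq := by
    let sB := IsPullback.of_hasPullback p t
    let sA := IsPullback.of_hasPullback (pullback.snd p t) j
    have sAY := sA.paste_horiz sB
    have hu : u ≫ pushforwardπ p q = j ≫ t := sq.w
    have w : (pullback.fst (pullback.snd p t) j ≫ pullback.fst p t) ≫ p =
        pullback.snd (pullback.snd p t) j ≫ u ≫ pushforwardπ p q := by rw [hu, sAY.w]
    have := H _ _ _ _ _ sA sB
    have sq' : CommSq (pushforwardEval u w) (pullback.fst (pullback.snd p t) j) q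
        (pullback.fst p t) := ⟨by rw [pushforwardEval_comp]⟩
    obtain ⟨v, hv, hv'⟩ := exists_pushforward_lift sB sq'.lift sq'.fac_right
    refine ⟨⟨⟨v, ?_, hv⟩⟩⟩
    refine pushforward_hom_ext sAY (t := j ≫ t) (by rw [Category.assoc, hv]) hu ?_
    rw [← sq'.fac_left, ← hv']
    refine (pushforwardEval_eq _ ?_ rfl).symm
    rw [sA.w_assoc]

theorem exists_section_of_hasLiftingProperty_pushforwardπ {X Y E A A' : SSet.{0}} {p : X ⟶ Y}
    {q : E ⟶ X} {j : A ⟶ Y} {j' : A' ⟶ X} {a : A' ⟶ A} (sq : IsPullback j' a p j)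
    (h : HasLiftingProperty j (pushforwardπ p q)) (s : A' ⟶ E) (hs : s ≫ q = j') :
    ∃ L : X ⟶ E, L ≫ q = 𝟙 X ∧ j' ≫ L = s := by
  obtain ⟨u, hu, hu'⟩ := exists_pushforward_lift sq s hs
  have sq' : CommSq u j (pushforwardπ p q) (𝟙 Y) := ⟨by simp [hu]⟩
  refine ⟨pushforwardEval (g := p) (h := 𝟙 X) sq'.lift (by simp), pushforwardEval_comp _ _, ?_⟩
  rw [← hu']
  refine pushforwardEval_eq _ ?_ (Category.comp_id _)
  rw [sq.w_assoc, sq'.fac_left]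

theorem anodyneExtensions_ept (X : SSet.{0}) (k : Fin 2) : anodyneExtensions (ept X k) := by
  refine (anodyneExtensions.arrow_mk_iso_iff ?_).1
    ((anodyneExtensions_cst k).whiskerLeft X)
  let e : X ⊗ Δ[0] ≅ X :=
    { hom := SemiCartesianMonoidalCategory.fst X Δ[0]
      inv := CartesianMonoidalCategory.lift (𝟙 X) (toPt X)
      hom_inv_id := CartesianMonoidalCategory.hom_ext _ _ (by simp) stdSimplex.ext₀
      inv_hom_id := CartesianMonoidalCategory.lift_fst _ _ }
  exact Arrow.isoMk e (Iso.refl _) rfl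

/-- A map `j : M ⟶ N` which is the inclusion of a deformation retract in the weak sense that
a self-homotopy of `N` preserving `M` deforms the identity into a map with values in `M`. -/
structure Deformable {M N : SSet.{0}} (j : M ⟶ N) : Prop where
  mono : Mono j
  exists_homotopy : ∃ (k k' : Fin 2) (H : N ⊗ Δ[1] ⟶ N) (H' : M ⊗ Δ[1] ⟶ M) (r : N ⟶ M),
    ept N k ≫ H = 𝟙 N ∧ ept N k' ≫ H = r ≫ j ∧ H' ≫ j = j ▷ Δ[1] ≫ H

theorem Deformable.anodyneExtensions_of_isPullback {M N X X' : SSet.{0}} {j : M ⟶ N}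
    (hj : Deformable j) {p : X ⟶ N} (hp : KanFibration p) {j' : X' ⟶ X} {p' : X' ⟶ M}
    (sq : IsPullback j' p' p j) : anodyneExtensions j' := by
  have := hj.mono
  have : Mono j' := MorphismProperty.of_isPullback (P := .monomorphisms _) sq.flip hj.mono
  obtain ⟨k, k', H, H', r, h1, h2, h3⟩ := hj.exists_homotopy
  have := hp.lift (anodyneExtensions_ept X k)
  have sqG : CommSq (𝟙 X) (ept X k) p (p ▷ Δ[1] ≫ H) := ⟨by
    rw [← Category.assoc, ept_whiskerRight, Category.assoc, h1, Category.id_comp,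
      Category.comp_id]⟩
  let G := sqG.lift
  have hG : ept X k ≫ G = 𝟙 X := sqG.fac_left
  have hGp : G ≫ p = p ▷ Δ[1] ≫ H := sqG.fac_right
  let G' : X' ⊗ Δ[1] ⟶ X' := sq.lift (j' ▷ Δ[1] ≫ G) (p' ▷ Δ[1] ≫ H') (by
    rw [Category.assoc, hGp, Category.assoc, h3, ← comp_whiskerRight_assoc, sq.w,
      comp_whiskerRight_assoc])
  have hG' : G' ≫ j' = j' ▷ Δ[1] ≫ G := sq.lift_fst _ _ _
  let ρ : X ⟶ X' := sq.lift (ept X k' ≫ G) (p ≫ r) (by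
    rw [Category.assoc, hGp, Category.assoc, ← h2, ← Category.assoc, ept_whiskerRight,
      Category.assoc])
  have hρ : ρ ≫ j' = ept X k' ≫ G := sq.lift_fst _ _ _
  rw [anodyneExtensions_iff]
  intro E Z q hq
  refine ⟨fun {u v} sq₂ => ?_⟩
  obtain ⟨L, hL1, hL2, hL3⟩ := exists_homotopy_lift j' hq k' (ρ ≫ u) (G' ≫ u) (G ≫ v)
    (by
      rw [← Category.assoc, ← Category.assoc]
      congr 1
      rw [← cancel_mono j', Category.assoc, hρ, Category.assoc, hG', ← Category.assoc,
        ← ept_whiskerRight, Category.assoc])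
    (by rw [Category.assoc, sq₂.w, ← Category.assoc, hρ, Category.assoc])
    (by rw [Category.assoc, sq₂.w, ← Category.assoc, hG', Category.assoc])
  refine ⟨⟨⟨ept X k ≫ L, ?_, ?_⟩⟩⟩
  · rw [← Category.assoc, ← ept_whiskerRight, Category.assoc, hL2, ← Category.assoc]
    have : ept X' k ≫ G' = 𝟙 X' := by
      rw [← cancel_mono j', Category.assoc, hG', ← Category.assoc, ept_whiskerRight,
        Category.assoc, hG, Category.comp_id, Category.id_comp]
    rw [this, Category.id_comp]
  · rw [Category.assoc, hL3, ← Category.assoc, hG, Category.id_comp]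

theorem Deformable.anodyneExtensions {M N : SSet.{0}} {j : M ⟶ N} (hj : Deformable j) :
    anodyneExtensions j :=
  hj.anodyneExtensions_of_isPullback (KanFibration.of_isIso (𝟙 N))
    (IsPullback.of_vert_isIso ⟨by simp⟩ : IsPullback j (𝟙 M) (𝟙 N) j)

/-- The homotopy of the simplex given by a monotone map. -/
def simplexHomotopy {n : ℕ} (θ : Fin (n + 1) × Fin 2 →o Fin (n + 1)) :
    (Δ[n] : SSet.{0}) ⊗ Δ[1] ⟶ Δ[n] where
  app _ := ↾fun x => stdSimplex.objMk
    (θ.comp ((stdSimplex.asOrderHom x.1).prod (stdSimplex.asOrderHom x.2)))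
  naturality _ _ _ := rfl

/-- The data of a horn inclusion being deformable, to a subcomplex of the horn which is
a retract of the simplex. -/
theorem horn_deformable (n : ℕ) (i : Fin (n + 2)) :
    Deformable (horn.{0} (n + 1) i).ι ∧
      ∃ (C : SSet.{0}) (c : C ⟶ (horn.{0} (n + 1) i : SSet.{0})) (r : Δ[n + 1] ⟶ C),
        Deformable c ∧ c ≫ (horn.{0} (n + 1) i).ι ≫ r = 𝟙 C := by
  obtain ⟨θ, k, k', j, hmono, hk, hk', hji, hj, hθ⟩ :
      ∃ (θ : Fin (n + 2) × Fin 2 → Fin (n + 2)) (k k' : Fin 2) (j : Fin (n + 2)),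
        Monotone θ ∧ (∀ x, θ (x, k) = x) ∧ (∀ x, θ (θ (x, k'), k') = θ (x, k')) ∧ j ≠ i ∧
          (∀ x, θ (x, k') ≠ j) ∧ ∀ x t, θ (x, t) = x ∨ θ (x, t) = i := by
    by_cases hi : i = 0
    · subst hi
      refine ⟨fun x => if x.2 = 0 then 0 else x.1, 1, 0, Fin.last _, ?_, ?_, ?_, ?_, ?_, ?_⟩
      · rintro ⟨a, b⟩ ⟨c, d⟩ ⟨h1, h2⟩
        dsimp at h1 h2 ⊢
        split_ifs
        · exact le_rfl
        · exact Fin.zero_le _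
        · exfalso; lia
        · exact h1
      · intro x; simp
      · intro x; simp
      · simp
      · intro x; simp [eq_comm]
      · intro x t
        by_cases ht : t = 0
        · right; simp [ht]
        · left; simp [ht]
    · refine ⟨fun x => if x.2 = 0 then x.1 else max x.1 i, 0, 1, 0, ?_, ?_, ?_, ?_, ?_, ?_⟩
      · rintro ⟨a, b⟩ ⟨c, d⟩ ⟨h1, h2⟩
        dsimp at h1 h2 ⊢
        split_ifs
        · exact h1
        · exact h1.trans (le_max_left _ _)
        · exfalso; lia
        · exact max_le_max_right _ h1
      · intro x; simp
      · intro x; simp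
      · exact Ne.symm hi
      · intro x
        have : 0 < i := Fin.pos_of_ne_zero hi
        simpa using (lt_max_of_lt_right this).ne'
      · intro x t
        by_cases ht : t = 0
        · left; simp [ht]
        · rcases max_choice x i with h | h
          · left; simpa [ht] using h
          · right; simpa [ht] using h
  let H := simplexHomotopy ⟨θ, hmono⟩
  have hH : ∀ (m : SimplexCategoryᵒᵖ) (x : (Δ[n + 1] : SSet.{0}).obj m) (t : (Δ[1] : SSet.{0}).obj m)
      (a : Fin (m.unop.len + 1)), stdSimplex.asOrderHom (H.app m (x, t)) a =
        θ (stdSimplex.asOrderHom x a, stdSimplex.asOrderHom t a) := fun _ _ _ _ => rfl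
  let Λ := horn.{0} (n + 1) i
  have memΛ : ∀ (m : SimplexCategoryᵒᵖ) (x : (Δ[n + 1] : SSet.{0}).obj m), x ∈ Λ.obj m ↔
      ∃ b, b ≠ i ∧ ∀ a, stdSimplex.asOrderHom x a ≠ b := by
    intro m x
    rw [mem_horn_iff, ne_eq, Set.eq_univ_iff_forall]
    push Not
    refine exists_congr fun b => ?_
    simp
  let C : (Δ[n + 1] : SSet.{0}).Subcomplex :=
    { obj m := {x | ∀ a, θ (stdSimplex.asOrderHom x a, k') = stdSimplex.asOrderHom x a}
      map φ x hx a := hx _ }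
  have memC : ∀ (m : SimplexCategoryᵒᵖ) (x : (Δ[n + 1] : SSet.{0}).obj m), x ∈ C.obj m ↔
      ∀ a, θ (stdSimplex.asOrderHom x a, k') = stdSimplex.asOrderHom x a := fun _ _ => Iff.rfl
  have hC : C ≤ Λ := by
    intro m x hx
    rw [memΛ]
    exact ⟨j, hji, fun a => by rw [← hx a]; exact hj _⟩
  let r : Δ[n + 1] ⟶ (C : SSet.{0}) := Subcomplex.lift (ept _ k' ≫ H) (by
    rintro m _ ⟨x, rfl⟩
    rw [memC]
    intro a
    exact hk' _)
  have hr : r ≫ C.ι = ept _ k' ≫ H := rfl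
  have h0 : ept _ k ≫ H = 𝟙 Δ[n + 1] := by
    ext m x
    apply stdSimplex_ext
    intro a
    exact hk _
  have hθi : ∀ t, θ (i, t) = i := fun t => by rcases hθ i t with h | h <;> exact h
  let HC : (C : SSet.{0}) ⊗ Δ[1] ⟶ C := Subcomplex.lift (C.ι ▷ Δ[1] ≫ H) (by
    rintro m _ ⟨⟨x, t⟩, rfl⟩
    rw [memC]
    intro a
    rcases hθ (stdSimplex.asOrderHom x.1 a) (stdSimplex.asOrderHom t a) with h | h
    · refine (congrArg (fun z => θ (z, k')) h).trans ?_
      exact (x.2 a).trans h.symm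
    · refine (congrArg (fun z => θ (z, k')) h).trans ?_
      exact (hθi k').trans h.symm)
  let HΛ : (Λ : SSet.{0}) ⊗ Δ[1] ⟶ Λ := Subcomplex.lift (Λ.ι ▷ Δ[1] ≫ H) (by
    rintro m _ ⟨⟨x, t⟩, rfl⟩
    obtain ⟨b, hb, hb'⟩ := (memΛ m x.1).1 x.2
    rw [memΛ]
    refine ⟨b, hb, fun a ha => ?_⟩
    rcases hθ (stdSimplex.asOrderHom x.1 a) (stdSimplex.asOrderHom t a) with h | h
    · exact hb' a (h.symm.trans ha)
    · exact hb (ha.symm.trans h))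
  have hιHC : HC ≫ C.ι = C.ι ▷ Δ[1] ≫ H := rfl
  have hιHΛ : HΛ ≫ Λ.ι = Λ.ι ▷ Δ[1] ≫ H := rfl
  let c : (C : SSet.{0}) ⟶ Λ := Subcomplex.homOfLE hC
  have hc : c ≫ Λ.ι = C.ι := rfl
  refine ⟨⟨inferInstance, k, k', H, HΛ, r ≫ c, h0, ?_, hιHΛ⟩, C, c, r,
    ⟨inferInstance, k, k', HΛ, HC, Λ.ι ≫ r, ?_, ?_, ?_⟩, ?_⟩
  · rw [Category.assoc]; exact hr.symm
  · rw [← cancel_mono Λ.ι, Category.assoc, hιHΛ, ← Category.assoc, ept_whiskerRight,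
      Category.assoc, h0, Category.comp_id, Category.id_comp]
  · rw [← cancel_mono Λ.ι, Category.assoc, hιHΛ, ← Category.assoc, ept_whiskerRight,
      Category.assoc, Category.assoc, Category.assoc, hc, hr]
  · rw [← cancel_mono Λ.ι, Category.assoc, Category.assoc, hc, hιHC, hιHΛ, ← hc,
      comp_whiskerRight_assoc]
  · rw [← cancel_mono C.ι, Category.assoc, Category.assoc, hr]
    ext m x
    apply stdSimplex_ext
    intro a
    exact x.2 a

theorem KanFibration.kanFibration_pushforwardπ {X Y E : SSet.{0}} {p : X ⟶ Y} {q : E ⟶ X}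
    (hp : KanFibration p) (hq : KanFibration q) : KanFibration (pushforwardπ p q) :=
  fun n i => hasLiftingProperty_pushforwardπ fun _ _ _ _ _ _ _ sqA sqB =>
    hq.lift ((horn_deformable n i).1.anodyneExtensions_of_isPullback (hp.of_isPullback sqB) sqA)

/-- The Frobenius property: anodyne maps are stable under pullback along Kan fibrations. -/
theorem KanFibration.anodyneExtensions_of_isPullback {M N X X' : SSet.{0}} {j : M ⟶ N}
    (hj : anodyneExtensions j) {p : X ⟶ N} (hp : KanFibration p) {j' : X' ⟶ X} {p' : X' ⟶ M}
    (sq : IsPullback j' p' p j) : anodyneExtensions j' := by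
  rw [anodyneExtensions_iff]
  intro E Z q hq
  refine ⟨fun {u v} sq₂ => ?_⟩
  have sq₃ := IsPullback.of_hasPullback v q
  have := (hp.kanFibration_pushforwardπ (hq.of_isPullback sq₃.flip)).lift hj
  obtain ⟨L, hL, hL'⟩ := exists_section_of_hasLiftingProperty_pushforwardπ sq this
    (sq₃.lift j' u sq₂.w.symm) (sq₃.lift_fst _ _ _)
  refine ⟨⟨⟨L ≫ pullback.snd v q, ?_, ?_⟩⟩⟩
  · rw [← Category.assoc, hL', sq₃.lift_snd]
  · rw [Category.assoc, ← sq₃.w, ← Category.assoc, hL, Category.id_comp]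

theorem TrivialFibration.trivialFibration_pushforwardπ {X Y E : SSet.{0}} {p : X ⟶ Y} {q : E ⟶ X}
    (hq : TrivialFibration q) : TrivialFibration (pushforwardπ p q) :=
  fun _ => hasLiftingProperty_pushforwardπ fun _ _ j' _ _ _ _ sqA _ => by
    have : Mono j' := MorphismProperty.of_isPullback (P := .monomorphisms _) sqA.flip
      (inferInstanceAs (Mono (boundary _).ι))
    exact hq.lift j'

theorem trivialFibration_of_fiberwise_deformation {Z P : SSet.{0}} {v : Z ⟶ P}
    (hv : KanFibration v) (g : P ⟶ Z) (hg : g ≫ v = 𝟙 P) (h : Z ⊗ Δ[1] ⟶ Z)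
    (h₀ : ept Z 0 ≫ h = v ≫ g) (h₁ : ept Z 1 ≫ h = 𝟙 Z)
    (hh : h ≫ v = SemiCartesianMonoidalCategory.fst Z Δ[1] ≫ v) : TrivialFibration v := by
  refine trivialFibration_of_lift fun S T m _ => ⟨fun {a b} sq => ?_⟩
  obtain ⟨L, hL1, hL2, hL3⟩ := exists_homotopy_lift m hv 0 (b ≫ g) (a ▷ Δ[1] ≫ h)
    (SemiCartesianMonoidalCategory.fst T Δ[1] ≫ b)
    (by rw [← Category.assoc, ← sq.w, ← Category.assoc, ept_whiskerRight, Category.assoc,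
      Category.assoc, h₀])
    (by rw [Category.assoc, hg, Category.comp_id, ← Category.assoc, ept_fst, Category.id_comp])
    (by
      rw [Category.assoc, hh, CartesianMonoidalCategory.whiskerRight_fst_assoc,
        CartesianMonoidalCategory.whiskerRight_fst_assoc, sq.w])
  refine ⟨⟨⟨ept T 1 ≫ L, ?_, ?_⟩⟩⟩
  · rw [← Category.assoc, ← ept_whiskerRight, Category.assoc, hL2, ← Category.assoc,
      ept_whiskerRight, Category.assoc, h₁, Category.comp_id]
  · rw [Category.assoc, hL3, ← Category.assoc, ept_fst, Category.id_comp]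

theorem trivialFibration_of_anodyneExtensions {X Z P : SSet.{0}} {t : X ⟶ Z} {v : Z ⟶ P}
    (hv : KanFibration v) (ht : anodyneExtensions t) (htv : anodyneExtensions (t ≫ v)) :
    TrivialFibration v := by
  have := hv.lift htv
  have sq : CommSq t (t ≫ v) v (𝟙 P) := ⟨by simp⟩
  obtain ⟨h, h0, h1, -, h3⟩ := exists_homotopy_lift_rel_ends ht hv (v ≫ sq.lift) (𝟙 Z)
    (SemiCartesianMonoidalCategory.fst X Δ[1] ≫ t) (SemiCartesianMonoidalCategory.fst Z Δ[1] ≫ v)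
    (by rw [← Category.assoc, sq.fac_left, ← Category.assoc, ept_fst, Category.id_comp])
    (by rw [← Category.assoc, ept_fst, Category.id_comp, Category.comp_id])
    (by rw [Category.assoc, sq.fac_right, ← Category.assoc, ept_fst, Category.id_comp,
      Category.comp_id])
    (by rw [← Category.assoc, ept_fst])
    (by rw [CartesianMonoidalCategory.whiskerRight_fst_assoc, Category.assoc])
  exact trivialFibration_of_fiberwise_deformation hv sq.lift sq.fac_right h h0 h1 h3

/-- Trivial fibrations extend along monomorphisms. -/
theorem TrivialFibration.exists_extension {Z P E : SSet.{0}} {v : Z ⟶ P}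
    (hv : TrivialFibration v) (i : P ⟶ E) [Mono i] :
    ∃ (Z' : SSet.{0}) (v' : Z' ⟶ E) (u : Z ⟶ Z'), TrivialFibration v' ∧ IsPullback u v v' i := by
  have sq : ∀ {W : SSet.{0}} (x : W ⟶ P), IsPullback x (𝟙 W) i (x ≫ i) := by
    intro W x
    rw [isPullback_iff_app]
    refine ⟨by simp, fun _ _ _ _ h => h, fun m a b hab => ⟨b, ?_, rfl⟩⟩
    exact ((mono_iff_injective _).1 ((NatTrans.mono_iff_mono_app i).1 inferInstance m) hab).symm
  obtain ⟨u, hu, hu'⟩ := exists_pushforward_lift (sq v) (𝟙 Z) (Category.id_comp v)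
  refine ⟨_, pushforwardπ i v, u, hv.trivialFibration_pushforwardπ, ⟨⟨hu⟩, ⟨PullbackCone.IsLimit.mk hu
    (fun s => pushforwardEval (g := 𝟙 _) (h := s.snd) s.fst
      (by rw [Category.id_comp, s.condition])) ?_ ?_ ?_⟩⟩⟩
  · intro s
    refine pushforward_hom_ext (sq s.snd) ?_ s.condition ?_
    · rw [Category.assoc, hu, ← Category.assoc, pushforwardEval_comp]
    · rw [← pushforwardEval_eq (w := (by rw [hu, Category.id_comp])) (u := u) (g := 𝟙 Z) (h := v),
        hu', Category.comp_id]
      · simp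
      · exact pushforwardEval_comp _ _
  · intro s
    exact pushforwardEval_comp _ _
  · intro s l hl hl'
    rw [← Category.comp_id l, ← hu']
    exact pushforwardEval_eq _ (by rw [Category.id_comp, Category.id_comp, hl]) hl'

theorem injective_app {X Y : SSet.{0}} (f : X ⟶ Y) [Mono f] (m : SimplexCategoryᵒᵖ) :
    Function.Injective (f.app m) :=
  (mono_iff_injective _).1 ((NatTrans.mono_iff_mono_app f).1 inferInstance m)

theorem mono_desc_of_isPullback {A Z S T P : SSet.{0}} {f : A ⟶ Z} {g : A ⟶ S} {u : Z ⟶ T}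
    {v : S ⟶ T} [Mono u] [Mono v] (sq : IsPullback f g u v) {l : Z ⟶ P} {r : S ⟶ P}
    (po : IsPushout f g l r) {m : P ⟶ T} (hl : l ≫ m = u) (hr : r ≫ m = v) : Mono m := by
  have po' : IsPushout f g (pushout.inl (pullback.fst u v) (pullback.snd u v))
      (pushout.inr (pullback.fst u v) (pullback.snd u v)) :=
    (IsPushout.of_hasPushout _ _).of_iso sq.isoPullback.symm (Iso.refl _) (Iso.refl _)
      (Iso.refl _) (by simp) (by simp) (by simp) (by simp)
  have : m = (po.isoIsPushout _ _ po').hom ≫ pushout.desc u v pullback.condition := by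
    apply po.hom_ext
    · rw [hl, ← Category.assoc, IsPushout.inl_isoIsPushout_hom, pushout.inl_desc]
    · rw [hr, ← Category.assoc, IsPushout.inr_isoIsPushout_hom, pushout.inr_desc]
  rw [this]
  infer_instance

/-- Kan fibrations extend along an inclusion `A ⟶ D` such that an anodyne subobject
of `A` is a retract of `D`. -/
theorem KanFibration.exists_extension_of_retract {A C D X : SSet.{0}} {c : C ⟶ A}
    (hc : anodyneExtensions c) (i : A ⟶ D) [Mono i] (r : D ⟶ C) (hr : c ≫ i ≫ r = 𝟙 C)
    {p : X ⟶ A} (hp : KanFibration p) :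
    ∃ (X' : SSet.{0}) (p' : X' ⟶ D) (e : X ⟶ X'), KanFibration p' ∧ IsPullback e p p' i := by
  -- a trivial fibration over a constant family, restricting to a replacement of `p`
  have sqXC := IsPullback.of_hasPullback p c
  have hxc := hp.anodyneExtensions_of_isPullback hc sqXC
  set xc := pullback.fst p c
  set pc := pullback.snd p c
  have hpc : KanFibration pc := hp.of_isPullback sqXC
  have sqP := IsPullback.of_hasPullback pc (i ≫ r)
  set π₁ := pullback.fst pc (i ≫ r)
  set π₂ := pullback.snd pc (i ≫ r)
  have hπ₂ : KanFibration π₂ := hpc.of_isPullback sqP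
  have sqE := IsPullback.of_hasPullback pc r
  set ε₁ := pullback.fst pc r
  set ε₂ := pullback.snd pc r
  have hε₂ : KanFibration ε₂ := hpc.of_isPullback sqE
  let k := sqE.lift π₁ (π₂ ≫ i) (by rw [sqP.w, Category.assoc])
  have sqk : IsPullback k π₂ ε₂ i :=
    IsPullback.of_right (by rw [sqE.lift_fst]; exact sqP) (sqE.lift_snd _ _ _) sqE
  have : Mono k := MorphismProperty.of_isPullback (P := .monomorphisms _) sqk.flip
    (inferInstanceAs (Mono i))
  let s := sqP.lift (𝟙 _) (pc ≫ c) (by rw [Category.assoc, hr, Category.id_comp, Category.comp_id])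
  have hs₂ : s ≫ π₂ = pc ≫ c := sqP.lift_snd _ _ _
  have hs : anodyneExtensions s := by
    refine hπ₂.anodyneExtensions_of_isPullback (p' := pc) hc (IsPullback.of_right ?_ hs₂ sqP)
    rw [sqP.lift_fst, hr]
    exact IsPullback.of_horiz_isIso ⟨by simp⟩
  have := hπ₂.lift hxc
  have sqw : CommSq s xc π₂ p := ⟨by rw [hs₂, sqXC.w]⟩
  obtain ⟨Z, z, v, hz, hv, hzv⟩ := exists_anodyne_kan_factorization sqw.lift
  have hv' : TrivialFibration v := by
    refine trivialFibration_of_anodyneExtensions hv (t := xc ≫ z)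
      (MorphismProperty.comp_mem _ _ _ hxc hz) ?_
    rwa [Category.assoc, hzv, sqw.fac_left]
  obtain ⟨Z', v', u, hv'', squ⟩ := hv'.exists_extension k
  have sqζ := squ.paste_vert sqk
  set ζ := v ≫ π₂ with hζdef
  set ζ' := v' ≫ ε₂
  have hζ : KanFibration ζ := hv.comp hπ₂
  have hζ' : KanFibration ζ' := hv''.kanFibration.comp hε₂
  have hzζ : z ≫ ζ = p := by rw [hζdef, ← Category.assoc, hzv, sqw.fac_right]
  clear_value ζ ζ'
  have := mono_of_anodyneExtensions hz
  have : Mono u := MorphismProperty.of_isPullback (P := .monomorphisms _) sqζ.flip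
    (inferInstanceAs (Mono i))
  -- `X` is a deformation retract of `Z` over `A`
  have := hp.lift hz
  have sqρ : CommSq (𝟙 X) z p ζ := ⟨by rw [hzζ, Category.id_comp]⟩
  obtain ⟨h, h0, h1, h2, h3⟩ := exists_homotopy_lift_rel_ends hz hζ (𝟙 Z) (sqρ.lift ≫ z)
    (SemiCartesianMonoidalCategory.fst X Δ[1] ≫ z) (SemiCartesianMonoidalCategory.fst Z Δ[1] ≫ ζ)
    (by rw [← Category.assoc, ept_fst, Category.id_comp, Category.comp_id])
    (by rw [← Category.assoc, sqρ.fac_left, ← Category.assoc, ept_fst])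
    (by rw [← Category.assoc, ept_fst])
    (by rw [Category.assoc, hzζ, sqρ.fac_right, ← Category.assoc, ept_fst, Category.id_comp])
    (by rw [CartesianMonoidalCategory.whiskerRight_fst_assoc, Category.assoc])
  set ρ := sqρ.lift
  -- the largest subcomplex of `Z'` which meets `Z` in `X`
  let X' : Z'.Subcomplex :=
    { obj n := {y | ∀ (m : SimplexCategoryᵒᵖ) (θ : n ⟶ m) (a : Z.obj m),
        u.app m a = Z'.map θ y → ∃ x : X.obj m, u.app m (z.app m x) = Z'.map θ y}
      map φ y hy m θ a ha := by
        obtain ⟨x, hx⟩ := hy m (φ ≫ θ) a (by rw [ha, Functor.map_comp_apply])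
        exact ⟨x, by rw [hx, Functor.map_comp_apply]⟩ }
  have memX' : ∀ {n : SimplexCategoryᵒᵖ} (y : Z'.obj n), y ∈ X'.obj n ↔
      ∀ (m : SimplexCategoryᵒᵖ) (θ : n ⟶ m) (a : Z.obj m),
        u.app m a = Z'.map θ y → ∃ x : X.obj m, u.app m (z.app m x) = Z'.map θ y :=
    fun _ => Iff.rfl
  let e : X ⟶ X' := Subcomplex.lift (z ≫ u) (by
    rintro n _ ⟨x, rfl⟩
    rw [memX']
    intro m θ a ha
    refine ⟨X.map θ x, ?_⟩
    rw [NatTrans.naturality_apply, NatTrans.naturality_apply]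
    rfl)
  have he : e ≫ X'.ι = z ≫ u := rfl
  have sqX' : IsPullback z e u X'.ι := by
    rw [isPullback_iff_app]
    refine ⟨he.symm, fun m x y hx _ => injective_app z m hx, fun m a y hay => ?_⟩
    obtain ⟨x, hx⟩ := (memX' _).1 y.2 m (𝟙 m) a (by rw [Functor.map_id_apply]; exact hay)
    rw [Functor.map_id_apply] at hx
    refine ⟨x, injective_app u m (hx.trans hay.symm), Subtype.ext hx⟩
  refine ⟨X', X'.ι ≫ ζ', e, ?_, ?_⟩
  · let m : pushout z e ⟶ Z' := pushout.desc u X'.ι sqX'.w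
    have hm : Mono m := mono_desc_of_isPullback sqX' (IsPushout.of_hasPushout z e) (pushout.inl_desc _ _ _)
      (pushout.inr_desc _ _ _)
    have hm1 : pushout.inl z e ≫ m = u := pushout.inl_desc _ _ _
    have hm2 : pushout.inr z e ≫ m = X'.ι := pushout.inr_desc _ _ _
    have po := (IsPushout.of_hasPushout z e).map (tensorRight (Δ[1] : SSet.{0}))
    let hS := po.desc (h ≫ u) (SemiCartesianMonoidalCategory.fst _ _ ≫ X'.ι) (by
      change z ▷ Δ[1] ≫ h ≫ u = e ▷ Δ[1] ≫ _
      rw [← Category.assoc, h2, CartesianMonoidalCategory.whiskerRight_fst_assoc, he,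
        Category.assoc])
    have hS1 : pushout.inl z e ▷ Δ[1] ≫ hS = h ≫ u := po.inl_desc _ _ _
    have hS2 : pushout.inr z e ▷ Δ[1] ≫ hS = SemiCartesianMonoidalCategory.fst _ _ ≫ X'.ι :=
      po.inr_desc _ _ _
    obtain ⟨G, hG1, hG2, hG3⟩ := exists_homotopy_lift m hζ' 0 (𝟙 Z') hS
      (SemiCartesianMonoidalCategory.fst Z' Δ[1] ≫ ζ')
      (by
        apply pushout.hom_ext
        · rw [Category.comp_id, hm1, ← Category.assoc, ← ept_whiskerRight, Category.assoc, hS1,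
            ← Category.assoc, h0, Category.id_comp]
        · rw [Category.comp_id, hm2, ← Category.assoc, ← ept_whiskerRight, Category.assoc, hS2,
            ← Category.assoc, ept_fst, Category.id_comp])
      (by rw [← Category.assoc, ept_fst])
      (by
        apply po.hom_ext
        · change _ ▷ _ ≫ _ = _ ▷ _ ≫ _
          rw [← Category.assoc, hS1, Category.assoc, sqζ.w, ← Category.assoc, h3,
            ← comp_whiskerRight_assoc, hm1, CartesianMonoidalCategory.whiskerRight_fst_assoc,
            sqζ.w, Category.assoc]
        · change _ ▷ _ ≫ _ = _ ▷ _ ≫ _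
          rw [← Category.assoc, hS2, ← comp_whiskerRight_assoc, hm2,
            CartesianMonoidalCategory.whiskerRight_fst_assoc, Category.assoc])
    have hG4 : u ≫ ept Z' 1 ≫ G = ρ ≫ z ≫ u := by
      rw [← Category.assoc, ← ept_whiskerRight, ← hm1, comp_whiskerRight, Category.assoc,
        Category.assoc, hG2, hS1, ← Category.assoc, h1, Category.assoc, hm1]
    have hG5 : X'.ι ≫ ept Z' 1 ≫ G = X'.ι := by
      rw [← Category.assoc, ← ept_whiskerRight, ← hm2, comp_whiskerRight, Category.assoc,
        Category.assoc, hG2, hS2, ← Category.assoc, ept_fst, Category.id_comp, hm2]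
    have hG6 : (ept Z' 1 ≫ G) ≫ ζ' = ζ' := by
      rw [Category.assoc, hG3, ← Category.assoc, ept_fst, Category.id_comp]
    obtain ⟨-, -, pbζ⟩ := isPullback_iff_app.1 sqζ
    let R : Z' ⟶ X' := Subcomplex.lift (ept Z' 1 ≫ G) (by
      rintro n _ ⟨y, rfl⟩
      rw [memX']
      intro m θ a ha
      rw [← NatTrans.naturality_apply] at ha ⊢
      obtain ⟨b, hb, -⟩ := pbζ m (Z'.map θ y) (ζ.app m a) (by
        rw [← app_congr hG6 m]
        exact (congrArg (ζ'.app m) ha.symm).trans (app_congr sqζ.w m a))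
      refine ⟨ρ.app m b, ?_⟩
      rw [← hb]
      exact (app_congr hG4 m b).symm)
    have hR : R ≫ X'.ι = ept Z' 1 ≫ G := rfl
    refine hζ'.of_retract
      { i := Arrow.homMk X'.ι (𝟙 D)
        r := Arrow.homMk R (𝟙 D) (by
          change R ≫ X'.ι ≫ ζ' = ζ' ≫ 𝟙 D
          rw [← Category.assoc, hR, hG6, Category.comp_id])
        retract := ?_ }
    ext : 1
    · change X'.ι ≫ R = 𝟙 _
      rw [← cancel_mono X'.ι, Category.assoc, hR, hG5, Category.id_comp]
    · exact Category.comp_id _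
  · obtain ⟨-, -, pbζ⟩ := isPullback_iff_app.1 sqζ
    obtain ⟨-, -, pbX'⟩ := isPullback_iff_app.1 sqX'
    rw [isPullback_iff_app]
    refine ⟨?_, fun m x y hx _ => ?_, fun m y a hya => ?_⟩
    · rw [← Category.assoc, he, Category.assoc, sqζ.w, ← Category.assoc, hzζ]
    · exact injective_app z m (injective_app u m (congrArg Subtype.val hx))
    · obtain ⟨b, hb, hb'⟩ := pbζ m y.1 a hya
      obtain ⟨x, hx, hx'⟩ := pbX' m b y hb
      exact ⟨x, hx', by rw [← hb', ← hx, ← hzζ]; rfl⟩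

/-- Maps along which all Kan fibrations extend. -/
def kanExtending : MorphismProperty SSet.{0} := fun A B j =>
  ∀ ⦃X : SSet.{0}⦄ (p : X ⟶ A), KanFibration p →
    ∃ (X' : SSet.{0}) (p' : X' ⟶ B) (e : X ⟶ X'), KanFibration p' ∧ IsPullback e p p' j

theorem coproducts_J_le_anodyneExtensions :
    MorphismProperty.coproducts.{0} modelCategoryQuillen.J.{0} ≤ anodyneExtensions :=
  (MorphismProperty.coproducts_monotone (MorphismProperty.le_llp_rlp _)).trans
    (MorphismProperty.coproducts_le _)

theorem exists_anodyne_retract_of_J {A D : SSet.{0}} {g : A ⟶ D} (hg : modelCategoryQuillen.J g) :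
    ∃ (C : SSet.{0}) (c : C ⟶ A) (r : D ⟶ C), anodyneExtensions c ∧ c ≫ g ≫ r = 𝟙 C := by
  simp only [modelCategoryQuillen.J, MorphismProperty.iSup_iff] at hg
  obtain ⟨n, ⟨i⟩⟩ := hg
  obtain ⟨-, C, c, r, hc, h⟩ := horn_deformable n i
  exact ⟨C, c, r, hc.anodyneExtensions, h⟩

theorem coproducts_J_le_kanExtending :
    MorphismProperty.coproducts.{0} modelCategoryQuillen.J.{0} ≤ kanExtending := by
  intro A D j hj X p hp
  have hj' := coproducts_J_le_anodyneExtensions _ hj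
  have := mono_of_anodyneExtensions hj'
  rw [MorphismProperty.coproducts_iff] at hj
  obtain ⟨I, hj⟩ := hj
  obtain ⟨F, G, cA, cD, hA, hD, f, hf⟩ := hj
  have key : ∀ i : Discrete I, ∃ (C : SSet.{0}) (c : C ⟶ F.obj i) (r : G.obj i ⟶ C),
      anodyneExtensions c ∧ c ≫ f.app i ≫ r = 𝟙 C := by
    exact fun i => exists_anodyne_retract_of_J (hf i)
  choose C c r hc hr using key
  let i := hA.desc (Cocone.mk _ (f ≫ cD.ι))
  have hi : ∀ k, cA.ι.app k ≫ i = f.app k ≫ cD.ι.app k := fun k => hA.fac _ _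
  let cC : colimit (Discrete.functor fun k => C ⟨k⟩) ⟶ cA.pt := 
    colimit.desc _ (Cocone.mk _ (Discrete.natTrans fun k => c k ≫ cA.ι.app k))
  have hcC : ∀ k, colimit.ι (Discrete.functor fun k => C ⟨k⟩) k ≫ cC = c k ≫ cA.ι.app k :=
    fun k => colimit.ι_desc _ _
  let R : cD.pt ⟶ colimit (Discrete.functor fun k => C ⟨k⟩) :=
    hD.desc (Cocone.mk _ (Discrete.natTrans fun k => r k ≫
      colimit.ι (Discrete.functor fun k => C ⟨k⟩) k))
  have hR : ∀ k, cD.ι.app k ≫ R = r k ≫ colimit.ι (Discrete.functor fun k => C ⟨k⟩) k :=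
    fun k => hD.fac _ _
  refine hp.exists_extension_of_retract (c := cC) ?_ i R ?_
  · refine MorphismProperty.colimitsOfShape_le _ (MorphismProperty.colimitsOfShape.mk'
      (Discrete.functor fun k => C ⟨k⟩) F _ cA
      (colimit.isColimit _) hA (Discrete.natTrans c) (fun k => hc k) cC hcC)
  · refine colimit.hom_ext fun k => ?_
    rw [← Category.assoc, hcC, Category.assoc, ← Category.assoc (cA.ι.app k), hi, Category.assoc,
      hR, ← Category.assoc, ← Category.assoc, Category.assoc (c k), hr]
    rfl

theorem kanFibration_of_cover {X Y : SSet.{0}} {p : X ⟶ Y}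
    (h : ∀ (n : ℕ) (σ : Δ[n] ⟶ Y), ∃ (E B : SSet.{0}) (q : E ⟶ B) (e : E ⟶ X) (b : B ⟶ Y)
      (σ' : Δ[n] ⟶ B), KanFibration q ∧ IsPullback e q p b ∧ σ' ≫ b = σ) : KanFibration p := by
  intro n i
  refine ⟨fun {a s} sq => ?_⟩
  obtain ⟨E, B, q, e, b, σ', hq, pb, rfl⟩ := h _ s
  have := hq n i
  have sq' : CommSq (pb.lift a (Λ[n + 1, i].ι ≫ σ') (by rw [sq.w, Category.assoc]))
    Λ[n + 1, i].ι q σ' := ⟨pb.lift_snd _ _ _⟩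
  refine ⟨⟨⟨sq'.lift ≫ e, ?_, ?_⟩⟩⟩
  · rw [← Category.assoc, sq'.fac_left, pb.lift_fst]
  · rw [Category.assoc, pb.w, ← Category.assoc, sq'.fac_right]

theorem exists_factorization_of_isColimit {J : Type} [SmallCategory J] {F : J ⥤ SSet.{0}}
    {c : Cocone F} (hc : IsColimit c) {n : ℕ} (σ : Δ[n] ⟶ c.pt) :
    ∃ (j : J) (σ' : Δ[n] ⟶ F.obj j), σ' ≫ c.ι.app j = σ := by
  obtain ⟨j, y, hy⟩ := Types.jointly_surjective_of_isColimit
    (isColimitOfPreserves ((evaluation _ _).obj (Opposite.op ⦋n⦌)) hc) (yonedaEquiv σ)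
  refine ⟨j, yonedaEquiv.symm y, ?_⟩
  apply yonedaEquiv.injective
  rw [yonedaEquiv_comp, Equiv.apply_symm_apply]
  exact hy

theorem pushouts_le_kanExtending (W : MorphismProperty SSet.{0}) (hW : W ≤ kanExtending)
    (hW' : W ≤ .monomorphisms _) : W.pushouts ≤ kanExtending := by
  rintro Y Y' j ⟨A, D, i, a, d, hi, po⟩ X p hp
  have : Mono i := hW' _ hi
  have sqA := IsPullback.of_hasPullback p a
  obtain ⟨XD, pD, e, hpD, pbD⟩ := hW _ hi _ (hp.of_isPullback sqA)
  have po' := IsPushout.of_hasPushout (pullback.fst p a) e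
  have hw : pullback.fst p a ≫ p ≫ j = e ≫ pD ≫ d := by
    rw [← Category.assoc, sqA.w, Category.assoc, po.w, ← Category.assoc, ← pbD.w, Category.assoc]
  let P := pushout.desc (p ≫ j) (pD ≫ d) hw
  have hP1 : pushout.inl (pullback.fst p a) e ≫ P = p ≫ j := pushout.inl_desc _ _ _
  have hP2 : pushout.inr (pullback.fst p a) e ≫ P = pD ≫ d := pushout.inr_desc _ _ _
  obtain ⟨pb1, pb2⟩ := (Adhesive.van_kampen' po (pullback.fst p a) e (pushout.inl _ _)
    (pushout.inr _ _) (pullback.snd p a) p pD P sqA pbD ⟨hP1⟩ ⟨hP2⟩ ⟨po'.w⟩).1 po'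
  refine ⟨_, P, pushout.inl _ _, kanFibration_of_cover fun n σ => ?_, pb1⟩
  obtain ⟨k, σ', h⟩ := exists_factorization_of_isColimit po.isColimit σ
  rcases k with _ | _ | _
  · exact ⟨_, _, _, _, _, σ' ≫ a, hp, pb1, (Category.assoc _ _ _).trans h⟩
  · exact ⟨_, _, _, _, _, σ', hp, pb1, h⟩
  · exact ⟨_, _, _, _, _, σ', hpD, pb2, h⟩

theorem retracts_le_kanExtending (W : MorphismProperty SSet.{0}) (hW : W ≤ kanExtending) :
    W.retracts ≤ kanExtending := by
  rintro A B j ⟨A', B', j', h, hj'⟩ X p hp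
  have sq := IsPullback.of_hasPullback p h.r.left
  obtain ⟨X', p', e, hp', pb⟩ := hW _ hj' _ (hp.of_isPullback sq)
  have sq' := IsPullback.of_hasPullback p' h.i.right
  let s := sq.lift (𝟙 X) (p ≫ h.i.left) (by simp)
  have hs : IsPullback s p (pullback.snd p h.r.left) h.i.left :=
    IsPullback.of_right (by
      rw [sq.lift_fst, h.retract_left]
      exact IsPullback.of_horiz_isIso ⟨by simp⟩) (sq.lift_snd _ _ _) sq
  have hs' := hs.paste_horiz pb
  have hw : h.i.left ≫ j' = j ≫ h.i.right := h.i_w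
  rw [hw] at hs'
  exact ⟨_, _, sq'.lift (s ≫ e) (p ≫ j) (by rw [hs'.w, Category.assoc]), hp'.of_isPullback sq',
    IsPullback.of_right (by rw [sq'.lift_fst]; exact hs') (sq'.lift_snd _ _ _) sq'⟩

theorem transfiniteCompositionsOfShape_le_kanExtending (W : MorphismProperty SSet.{0})
    (hW : W ≤ kanExtending) : W.transfiniteCompositionsOfShape ℕ ≤ kanExtending := by
  rintro A B j ⟨h⟩ X p hp
  let F := h.F
  let c := h.incl
  have hstep : ∀ n, kanExtending (F.map (homOfLE (Nat.le_succ n))) := fun n =>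
    hW _ (h.map_mem n (not_isMax n))
  let S (n : ℕ) := {q : Over (F.obj n) // KanFibration q.hom}
  have next : ∀ n (q : S n), ∃ (q' : S (n + 1)) (e : q.1.left ⟶ q'.1.left),
      IsPullback e q.1.hom q'.1.hom (F.map (homOfLE (Nat.le_succ n))) := by
    intro n q
    obtain ⟨X', p', e, hp', pb⟩ := hstep n q.1.hom q.2
    exact ⟨⟨Over.mk p', hp'⟩, e, pb⟩
  choose N e he using next
  let s (n : ℕ) : S n := Nat.rec (motive := S) ⟨Over.mk (p ≫ h.isoBot.inv),
    hp.comp (KanFibration.of_isIso _)⟩ N n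
  let G : ℕ ⥤ SSet.{0} := Functor.ofSequence (X := fun n => (s n).1.left) fun n => e n (s n)
  let π : G ⟶ F := NatTrans.ofSequence (fun n => (s n).1.hom) fun n => by
    rw [Functor.ofSequence_map_homOfLE_succ]
    exact (he n (s n)).w
  have pbπ : ∀ {n m} (f : n ⟶ m), IsPullback (G.map f) (π.app n) (π.app m) (F.map f) := by
    intro n m f
    obtain ⟨k, rfl⟩ := Nat.exists_eq_add_of_le (leOfHom f)
    induction k with
    | zero =>
      obtain rfl : f = 𝟙 n := Subsingleton.elim _ _
      rw [G.map_id, F.map_id]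
      exact IsPullback.of_horiz_isIso ⟨by simp⟩
    | succ k ih =>
      obtain rfl : f = homOfLE (Nat.le_add_right n k) ≫ homOfLE (Nat.le_succ (n + k)) :=
        Subsingleton.elim _ _
      rw [G.map_comp, F.map_comp]
      refine (ih _).paste_horiz ?_
      rw [Functor.ofSequence_map_homOfLE_succ]
      exact he _ _
  let P : colimit G ⟶ B := colimit.desc G (Cocone.mk B (π ≫ h.incl))
  have hP : ∀ n, colimit.ι G n ≫ P = π.app n ≫ c.app n := fun n => colimit.ι_desc _ _
  have hG := fun m => isColimitOfPreserves ((evaluation _ _).obj m) (colimit.isColimit G)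
  have hF := fun m => isColimitOfPreserves ((evaluation _ _).obj m) h.isColimit
  have pbc : ∀ n, IsPullback (colimit.ι G n) (π.app n) P (c.app n) := by
    intro n
    rw [isPullback_iff_app]
    refine ⟨hP n, fun m x y hxy hxy' => ?_, fun m x y hxy => ?_⟩
    · obtain ⟨k, f, hk⟩ := (Types.FilteredColimit.isColimit_eq_iff' (hG m) x y).1 hxy
      exact (isPullback_iff_app.1 (pbπ f)).2.1 m x y hk hxy'
    · obtain ⟨k, x, rfl⟩ := Types.jointly_surjective_of_isColimit (hG m) x
      obtain ⟨l, f, g, hl⟩ := (Types.FilteredColimit.isColimit_eq_iff _ (hF m)).1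
        ((app_congr (hP k) m x).symm.trans hxy)
      obtain ⟨z, hz, hz'⟩ := (isPullback_iff_app.1 (pbπ g)).2.2 m ((G.map f).app m x) y
        ((app_congr (π.naturality f) m x).trans hl)
      refine ⟨z, ?_, hz'⟩
      have h1 := app_congr (colimit.w G g) m z
      have h2 := app_congr (colimit.w G f) m x
      exact h1.symm.trans ((congrArg ((colimit.ι G l).app m) hz).trans h2)
  have e0 : IsPullback (𝟙 X) p (π.app 0) h.isoBot.inv :=
    IsPullback.of_horiz_isIso ⟨(Category.id_comp _)⟩
  refine ⟨_, P, _, kanFibration_of_cover fun n σ => ?_, h.fac ▸ e0.paste_horiz (pbc 0)⟩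
  obtain ⟨k, σ', hσ⟩ := exists_factorization_of_isColimit h.isColimit σ
  exact ⟨_, _, _, _, _, σ', (s k).2, pbc k, hσ⟩

theorem KanFibration.exists_extension {A B X : SSet.{0}} {j : A ⟶ B} (hj : anodyneExtensions j)
    {p : X ⟶ A} (hp : KanFibration p) :
    ∃ (X' : SSet.{0}) (p' : X' ⟶ B) (e : X ⟶ X'), KanFibration p' ∧ IsPullback e p p' j := by
  rw [anodyneExtensions_eq_retracts_transfiniteCompositionsOfShape] at hj
  refine retracts_le_kanExtending _ (transfiniteCompositionsOfShape_le_kanExtending _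
    (pushouts_le_kanExtending _ coproducts_J_le_kanExtending fun _ _ i hi => ?_)) _ hj _ hp
  exact mono_of_anodyneExtensions (coproducts_J_le_anodyneExtensions _ hi)

theorem Homotopic.refl {X Y : SSet.{0}} (f : X ⟶ Y) : Homotopic f f :=
  Relation.EqvGen.refl f

theorem Homotopic.symm {X Y : SSet.{0}} {f g : X ⟶ Y} (h : Homotopic f g) : Homotopic g f :=
  Relation.EqvGen.symm _ _ h

theorem Homotopic.trans {X Y : SSet.{0}} {f g h : X ⟶ Y} (h₁ : Homotopic f g)
    (h₂ : Homotopic g h) : Homotopic f h :=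
  Relation.EqvGen.trans _ _ _ h₁ h₂

theorem Homotopic.of_map {X Y X' Y' : SSet.{0}} (φ : (X ⟶ Y) → (X' ⟶ Y'))
    (hφ : ∀ f g, Homotopy f g → Homotopy (φ f) (φ g)) {f g : X ⟶ Y} (h : Homotopic f g) :
    Homotopic (φ f) (φ g) := by
  induction h with
  | rel f g h => exact Relation.EqvGen.rel _ _ (hφ f g h)
  | refl f => exact Homotopic.refl _
  | symm f g _ ih => exact ih.symm
  | trans f g k _ _ ih₁ ih₂ => exact ih₁.trans ih₂

theorem Homotopic.comp_left {W X Y : SSet.{0}} (k : W ⟶ X) {f g : X ⟶ Y} (h : Homotopic f g) :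
    Homotopic (k ≫ f) (k ≫ g) := by
  refine Homotopic.of_map (fun f => k ≫ f) ?_ h
  rintro f g ⟨H, rfl, rfl⟩
  exact ⟨k ▷ Δ[1] ≫ H, rfl, rfl⟩

theorem Homotopic.comp_right {X Y Z : SSet.{0}} {f g : X ⟶ Y} (h : Homotopic f g) (k : Y ⟶ Z) :
    Homotopic (f ≫ k) (g ≫ k) := by
  refine Homotopic.of_map (fun f => f ≫ k) ?_ h
  rintro f g ⟨H, rfl, rfl⟩
  exact ⟨H ≫ k, rfl, rfl⟩

theorem HomotopyEquivalence.comp {X Y Z : SSet.{0}} {f : X ⟶ Y} {g : Y ⟶ Z}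
    (hf : HomotopyEquivalence f) (hg : HomotopyEquivalence g) : HomotopyEquivalence (f ≫ g) := by
  obtain ⟨f', hf₁, hf₂⟩ := hf
  obtain ⟨g', hg₁, hg₂⟩ := hg
  exact ⟨g' ≫ f', (((hg₁.comp_right f').comp_left f)).trans hf₁,
    (((hf₂.comp_right g).comp_left g')).trans hg₂⟩

theorem HomotopyEquivalence.of_comp_left {X Y Z : SSet.{0}} {f : X ⟶ Y} {g : Y ⟶ Z}
    (hf : HomotopyEquivalence f) (hfg : HomotopyEquivalence (f ≫ g)) : HomotopyEquivalence g := by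
  obtain ⟨f', -, hf⟩ := hf
  obtain ⟨h, h₁, h₂⟩ := hfg
  exact ⟨h ≫ f, ((hf.comp_right (g ≫ h ≫ f)).symm.trans ((h₁.comp_right f).comp_left f')).trans hf,
    h₂⟩

theorem HomotopyEquivalence.of_comp_right {X Y Z : SSet.{0}} {f : X ⟶ Y} {g : Y ⟶ Z}
    (hg : HomotopyEquivalence g) (hfg : HomotopyEquivalence (f ≫ g)) : HomotopyEquivalence f := by
  obtain ⟨g', hg, -⟩ := hg
  obtain ⟨h, h₁, h₂⟩ := hfg
  exact ⟨g ≫ h, h₁, ((hg.comp_left (g ≫ h ≫ f)).symm.trans ((h₂.comp_right g').comp_left g)).trans hg⟩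

theorem WeakHomotopyEquivalence.comp {X Y Z : SSet.{0}} {f : X ⟶ Y} {g : Y ⟶ Z}
    (hf : WeakHomotopyEquivalence f) (hg : WeakHomotopyEquivalence g) :
    WeakHomotopyEquivalence (f ≫ g) := by
  intro K hK
  rw [MonoidalClosed.pre_map]
  exact (hg K hK).comp (hf K hK)

theorem WeakHomotopyEquivalence.of_comp_left {X Y Z : SSet.{0}} {f : X ⟶ Y} {g : Y ⟶ Z}
    (hf : WeakHomotopyEquivalence f) (hfg : WeakHomotopyEquivalence (f ≫ g)) :
    WeakHomotopyEquivalence g := by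
  intro K hK
  have := hfg K hK
  rw [MonoidalClosed.pre_map] at this
  exact (hf K hK).of_comp_right this

theorem WeakHomotopyEquivalence.of_comp_right {X Y Z : SSet.{0}} {f : X ⟶ Y} {g : Y ⟶ Z}
    (hg : WeakHomotopyEquivalence g) (hfg : WeakHomotopyEquivalence (f ≫ g)) :
    WeakHomotopyEquivalence f := by
  intro K hK
  have := hfg K hK
  rw [MonoidalClosed.pre_map] at this
  exact (hg K hK).of_comp_left this

theorem Homotopic.pre {X Y : SSet.{0}} {f g : X ⟶ Y} (h : Homotopic f g) (K : SSet.{0}) :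
    Homotopic ((MonoidalClosed.pre f).app K) ((MonoidalClosed.pre g).app K) := by
  refine Homotopic.of_map (fun f => (MonoidalClosed.pre f).app K) ?_ h
  rintro f g ⟨H, rfl, rfl⟩
  let A := (ihom Y).obj K
  let M : X ⊗ (A ⊗ Δ[1]) ⟶ Y ⊗ A := CartesianMonoidalCategory.lift
    (X ◁ SemiCartesianMonoidalCategory.snd A Δ[1] ≫ H)
    (SemiCartesianMonoidalCategory.snd _ _ ≫ SemiCartesianMonoidalCategory.fst A Δ[1])
  have hM : ∀ k, X ◁ ept A k ≫ M = (ept X k ≫ H) ▷ A := fun k => rfl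
  refine ⟨MonoidalClosed.curry (M ≫ (ihom.ev Y).app K), ?_, ?_⟩ <;>
    rw [← MonoidalClosed.curry_natural_left, ← Category.assoc, hM, ← MonoidalClosed.uncurry_pre,
      MonoidalClosed.curry_uncurry]

theorem HomotopyEquivalence.weakHomotopyEquivalence {X Y : SSet.{0}} {f : X ⟶ Y}
    (hf : HomotopyEquivalence f) : WeakHomotopyEquivalence f := by
  intro K _
  obtain ⟨g, h₁, h₂⟩ := hf
  refine ⟨(MonoidalClosed.pre g).app K, ?_, ?_⟩
  · have := h₂.pre K
    rwa [MonoidalClosed.pre_map, MonoidalClosed.pre_id] at this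
  · have := h₁.pre K
    rwa [MonoidalClosed.pre_map, MonoidalClosed.pre_id] at this

/-- The inclusion of a copy of `X` in `X ⊗ twoPts`. -/
def twoPtsInc (X : SSet.{0}) (k : Fin 2) : X ⟶ X ⊗ twoPts where
  app _ := ↾fun x => (x, k)
  naturality _ _ _ := rfl

theorem twoPts_tensor_hom_ext {X Z : SSet.{0}} {u v : X ⊗ twoPts ⟶ Z}
    (h : ∀ k, twoPtsInc X k ≫ u = twoPtsInc X k ≫ v) : u = v := by
  ext m ⟨x, k⟩
  exact app_congr (h k) m x

instance (X : SSet.{0}) : Mono (X ◁ twoPtsι) := by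
  rw [NatTrans.mono_iff_mono_app]
  intro m
  rw [mono_iff_injective]
  rintro ⟨x, k⟩ ⟨y, l⟩ h
  replace h : (x, twoPtsι.app m k) = (y, twoPtsι.app m l) := h
  obtain ⟨h₁, h₂⟩ := Prod.mk.inj h
  exact Prod.ext h₁ (injective_app twoPtsι m h₂)

theorem TrivialFibration.homotopyEquivalence {X Y : SSet.{0}} {p : X ⟶ Y}
    (hp : TrivialFibration p) : HomotopyEquivalence p := by
  have := hp.lift (initial.to Y)
  have sq : CommSq (initial.to X) (initial.to Y) p (𝟙 Y) := ⟨by simp⟩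
  have := hp.lift (X ◁ twoPtsι)
  have sq' : CommSq (twoPtsDesc ![p ≫ sq.lift, 𝟙 X]) (X ◁ twoPtsι) p
      (SemiCartesianMonoidalCategory.fst X Δ[1] ≫ p) := by
    constructor
    apply twoPts_tensor_hom_ext
    intro k
    fin_cases k
    · change (p ≫ sq.lift) ≫ p = p
      rw [Category.assoc, sq.fac_right, Category.comp_id]
    · rfl
  refine ⟨sq.lift, Relation.EqvGen.rel _ _ ⟨sq'.lift, ?_, ?_⟩, ?_⟩
  · exact congrArg (twoPtsInc X 0 ≫ ·) sq'.fac_left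
  · exact congrArg (twoPtsInc X 1 ≫ ·) sq'.fac_left
  · rw [sq.fac_right]
    exact Homotopic.refl _

theorem weakHomotopyEquivalence_of_anodyneExtensions {A B : SSet.{0}} {i : A ⟶ B}
    (hi : anodyneExtensions i) : WeakHomotopyEquivalence i := by
  intro K hK
  refine (trivialFibration_of_lift fun S T m _ => ⟨fun {u v} sq => ?_⟩).homotopyEquivalence
  obtain ⟨L, h₁, h₂, -⟩ := exists_lift_pushoutProduct i m (.inr ⟨hi, inferInstance⟩) hK
    (MonoidalClosed.uncurry u) (MonoidalClosed.uncurry v) (toPt _)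
    (by rw [← MonoidalClosed.uncurry_pre_app, sq.w, MonoidalClosed.uncurry_natural_left])
    (stdSimplex.ext₀) (stdSimplex.ext₀)
  refine ⟨⟨⟨MonoidalClosed.curry L, ?_, ?_⟩⟩⟩
  · rw [← MonoidalClosed.curry_natural_left, h₁, MonoidalClosed.curry_uncurry]
  · rw [MonoidalClosed.curry_pre_app, h₂, MonoidalClosed.curry_uncurry]

/-- The vertex of the exponential `K ^ X` corresponding to a map `X ⟶ K`. -/
noncomputable def toVertex {X K : SSet.{0}} (a : X ⟶ K) : Δ[0] ⟶ (ihom X).obj K :=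
  MonoidalClosed.curry (SemiCartesianMonoidalCategory.fst X Δ[0] ≫ a)

/-- The map `X ⟶ K` corresponding to a vertex of the exponential `K ^ X`. -/
noncomputable def ofVertex {X K : SSet.{0}} (x : Δ[0] ⟶ (ihom X).obj K) : X ⟶ K :=
  CartesianMonoidalCategory.lift (𝟙 X) (toPt X) ≫ MonoidalClosed.uncurry x

theorem ofVertex_toVertex {X K : SSet.{0}} (a : X ⟶ K) : ofVertex (toVertex a) = a := by
  rw [ofVertex, toVertex, MonoidalClosed.uncurry_curry, CartesianMonoidalCategory.lift_fst_assoc,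
    Category.id_comp]

theorem toVertex_comp_pre {X Y K : SSet.{0}} (f : X ⟶ Y) (a : Y ⟶ K) :
    toVertex a ≫ (MonoidalClosed.pre f).app K = toVertex (f ≫ a) := by
  rw [toVertex, MonoidalClosed.curry_pre_app]
  rfl

theorem ofVertex_comp_pre {X Y K : SSet.{0}} (f : X ⟶ Y) (x : Δ[0] ⟶ (ihom Y).obj K) :
    ofVertex (x ≫ (MonoidalClosed.pre f).app K) = f ≫ ofVertex x := by
  rw [ofVertex, MonoidalClosed.uncurry_pre_app]
  rfl

theorem Homotopic.toVertex {X K : SSet.{0}} {a b : X ⟶ K} (h : Homotopic a b) :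
    Homotopic (toVertex a) (Paper.toVertex b) := by
  refine Homotopic.of_map Paper.toVertex ?_ h
  rintro a b ⟨H, rfl, rfl⟩
  refine ⟨MonoidalClosed.curry (X ◁ SemiCartesianMonoidalCategory.snd Δ[0] Δ[1] ≫ H), ?_, ?_⟩ <;>
    (rw [← MonoidalClosed.curry_natural_left]; rfl)

theorem Homotopic.ofVertex {X K : SSet.{0}} {x y : Δ[0] ⟶ (ihom X).obj K} (h : Homotopic x y) :
    Homotopic (ofVertex x) (Paper.ofVertex y) := by
  refine Homotopic.of_map Paper.ofVertex ?_ h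
  rintro x y ⟨H, rfl, rfl⟩
  refine ⟨CartesianMonoidalCategory.lift (SemiCartesianMonoidalCategory.fst X Δ[1]) (toPt X ▷ Δ[1])
    ≫ MonoidalClosed.uncurry H, ?_, ?_⟩ <;>
    (rw [Paper.ofVertex, MonoidalClosed.uncurry_natural_left]; rfl)

theorem WeakHomotopyEquivalence.exists_extension_up_to_homotopy {X Y K : SSet.{0}} {f : X ⟶ Y}
    (hf : WeakHomotopyEquivalence f) (hK : KanComplex K) (a : X ⟶ K) :
    ∃ b : Y ⟶ K, Homotopic (f ≫ b) a := by
  obtain ⟨G, -, h⟩ := hf K hK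
  refine ⟨ofVertex (toVertex a ≫ G), ?_⟩
  rw [← ofVertex_comp_pre]
  nth_rw 2 [← ofVertex_toVertex a]
  exact (h.comp_left (toVertex a)).ofVertex

theorem WeakHomotopyEquivalence.homotopic_of_comp {X Y K : SSet.{0}} {f : X ⟶ Y}
    (hf : WeakHomotopyEquivalence f) (hK : KanComplex K) {a b : Y ⟶ K}
    (hab : Homotopic (f ≫ a) (f ≫ b)) : Homotopic a b := by
  obtain ⟨G, h, -⟩ := hf K hK
  have key : ∀ c : Y ⟶ K, Homotopic (ofVertex (toVertex (f ≫ c) ≫ G)) c := by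
    intro c
    have := (h.comp_left (toVertex c)).ofVertex
    rwa [← Category.assoc, toVertex_comp_pre, Category.comp_id, ofVertex_toVertex] at this
  exact ((key a).symm.trans (hab.toVertex.comp_right G).ofVertex).trans (key b)

theorem exists_homotopy_of_common_start {X E Y : SSet.{0}} {q : E ⟶ Y} (hq : KanFibration q)
    (h₁ h₂ : X ⊗ Δ[1] ⟶ E) (hs : ept X 0 ≫ h₁ = ept X 0 ≫ h₂) (hY : h₁ ≫ q = h₂ ≫ q) :
    ∃ h : X ⊗ Δ[1] ⟶ E, ept X 0 ≫ h = ept X 1 ≫ h₁ ∧ ept X 1 ≫ h = ept X 1 ≫ h₂ ∧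
      h ≫ q = SemiCartesianMonoidalCategory.fst X Δ[1] ≫ ept X 1 ≫ h₁ ≫ q := by
  let hh : Fin 2 → (X ⊗ Δ[1] ⟶ E) := ![h₁, h₂]
  let H : (X ⊗ twoPts) ⊗ Δ[1] ⟶ E :=
    { app m := ↾fun (x : (X.obj m × Fin 2) × (Δ[1] : SSet.{0}).obj m) =>
        (hh x.1.2).app m ((x.1.1, x.2) : X.obj m × (Δ[1] : SSet.{0}).obj m)
      naturality m m' φ := by
        ext x
        let y : (X ⊗ Δ[1]).obj m := (x.1.1, x.2)
        exact NatTrans.naturality_apply (hh x.1.2) φ y }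
  have ext2 : ∀ {Z : SSet.{0}} {u v : (X ⊗ twoPts) ⊗ Δ[1] ⟶ Z},
      (∀ k, twoPtsInc X k ▷ Δ[1] ≫ u = twoPtsInc X k ▷ Δ[1] ≫ v) → u = v := by
    intro Z u v h
    ext m ⟨⟨x, k⟩, t⟩
    exact app_congr (h k) m (x, t)
  obtain ⟨L, hL1, hL2, hL3⟩ := exists_homotopy_lift (X ◁ twoPtsι) hq 0
    (SemiCartesianMonoidalCategory.fst X Δ[1] ≫ ept X 0 ≫ h₁) H
    (SemiCartesianMonoidalCategory.fst X Δ[1] ▷ Δ[1] ≫ h₁ ≫ q)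
    (by
      apply twoPts_tensor_hom_ext
      intro k
      fin_cases k
      · rfl
      · exact hs)
    rfl
    (by
      apply ext2
      intro k
      fin_cases k
      · rfl
      · exact hY.symm)
  refine ⟨ept _ 1 ≫ L, ?_, ?_, ?_⟩
  · exact congrArg (fun l => twoPtsInc X 0 ≫ ept _ 1 ≫ l) hL2
  · exact congrArg (fun l => twoPtsInc X 1 ≫ ept _ 1 ≫ l) hL2
  · rw [Category.assoc, hL3]
    rfl

theorem Homotopy.refl {X Y : SSet.{0}} (f : X ⟶ Y) : Homotopy f f :=
  ⟨SemiCartesianMonoidalCategory.fst X Δ[1] ≫ f, rfl, rfl⟩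

theorem KanComplex.homotopy_of_homotopic {X K : SSet.{0}} (hK : KanComplex K) {f g : X ⟶ K}
    (h : Homotopic f g) : Homotopy f g := by
  have key : ∀ {f g k : X ⟶ K}, Homotopy f g → Homotopy f k → Homotopy g k := by
    rintro f _ _ ⟨h₁, hf, rfl⟩ ⟨h₂, hf', rfl⟩
    obtain ⟨h, h0, h1, -⟩ := exists_homotopy_of_common_start hK h₁ h₂ (hf.trans hf'.symm)
      stdSimplex.ext₀
    exact ⟨h, h0, h1⟩
  induction h with
  | rel f g h => exact h
  | refl f => exact Homotopy.refl f
  | symm f g _ ih => exact key ih (Homotopy.refl f)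
  | trans f g k _ _ ih₁ ih₂ => exact key (key ih₁ (Homotopy.refl f)) ih₂

theorem WeakHomotopyEquivalence.trivialFibration {E Y : SSet.{0}} {q : E ⟶ Y}
    (hw : WeakHomotopyEquivalence q) (hq : KanFibration q) (hE : KanComplex E)
    (hY : KanComplex Y) : TrivialFibration q := by
  obtain ⟨g₀, hg₀⟩ := hw.exists_extension_up_to_homotopy hE (𝟙 E)
  obtain ⟨H, hH₀, hH₁⟩ := hY.homotopy_of_homotopic (hw.homotopic_of_comp hY (a := g₀ ≫ q)
    (b := 𝟙 Y) (by simpa using hg₀.comp_right q))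
  have := hq.lift (anodyneExtensions_ept Y 0)
  have sq : CommSq g₀ (ept Y 0) q H := ⟨hH₀.symm⟩
  set g := ept Y 1 ≫ sq.lift with hgdef
  have hg : g ≫ q = 𝟙 Y := by rw [hgdef, Category.assoc, sq.fac_right, hH₁]
  have hgg : Homotopic g₀ g := Relation.EqvGen.rel _ _ ⟨sq.lift, sq.fac_left, rfl⟩
  obtain ⟨k, hk₀, hk₁⟩ := hE.homotopy_of_homotopic ((hgg.comp_left q).symm.trans hg₀)
  obtain ⟨h, h0, h1, h2⟩ := exists_homotopy_of_common_start hq (k ≫ q ≫ g) k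
    (by rw [← Category.assoc, hk₀, Category.assoc, ← Category.assoc g, hg, Category.id_comp])
    (by rw [Category.assoc, Category.assoc, hg, Category.comp_id])
  refine trivialFibration_of_fiberwise_deformation hq g hg h ?_ ?_ ?_
  · rw [h0, ← Category.assoc, hk₁, Category.id_comp]
  · rw [h1, hk₁]
  · rw [h2, Category.assoc, Category.assoc, hg, Category.comp_id, ← Category.assoc (ept E 1), hk₁,
      Category.id_comp]

theorem exists_anodyne_kanComplex (Y : SSet.{0}) :
    ∃ (Y' : SSet.{0}) (j : Y ⟶ Y'), anodyneExtensions j ∧ KanComplex Y' := by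
  obtain ⟨Y', j, r, hj, hr, -⟩ := exists_anodyne_kan_factorization (toPt Y)
  exact ⟨Y', j, hj, by rwa [KanComplex, stdSimplex.ext₀ (f := toPt Y') (g := r)]⟩

theorem KanFibration.weakHomotopyEquivalence_pullback_fst {X Y B : SSet.{0}} {p : X ⟶ Y}
    {f : B ⟶ Y} (hp : KanFibration p) (hf : WeakHomotopyEquivalence f) :
    WeakHomotopyEquivalence (pullback.fst p f) := by
  obtain ⟨Y', j, hj, hY'⟩ := exists_anodyne_kanComplex Y
  obtain ⟨X', p', e, hp', he⟩ := hp.exists_extension hj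
  obtain ⟨E, t, q, ht, hq, hfac⟩ := exists_anodyne_kan_factorization (f ≫ j)
  have hE : KanComplex E := by
    rw [KanComplex, stdSimplex.ext₀ (f := toPt E) (g := q ≫ toPt Y')]
    exact hq.comp hY'
  have hqt : TrivialFibration q := by
    refine WeakHomotopyEquivalence.trivialFibration ?_ hq hE hY'
    refine (weakHomotopyEquivalence_of_anodyneExtensions ht).of_comp_left ?_
    rw [hfac]
    exact hf.comp (weakHomotopyEquivalence_of_anodyneExtensions hj)
  have hsq : IsPullback (pullback.fst p f ≫ e) (pullback.snd p f) p' (t ≫ q) := by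
    rw [hfac]
    exact ((IsPullback.of_hasPullback p f).flip.paste_vert he.flip).flip
  have hE' := IsPullback.of_hasPullback p' q
  let s := hE'.lift (pullback.fst p f ≫ e) (pullback.snd p f ≫ t)
    (by rw [hsq.w, Category.assoc])
  have hs : IsPullback s (pullback.snd p f) (pullback.snd p' q) t := by
    refine IsPullback.of_right ?_ (hE'.lift_snd _ _ _) hE'
    rw [hE'.lift_fst]
    exact hsq
  refine WeakHomotopyEquivalence.of_comp_right (weakHomotopyEquivalence_of_anodyneExtensions
    (hp'.anodyneExtensions_of_isPullback hj he)) ?_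
  rw [← hE'.lift_fst (pullback.fst p f ≫ e) (pullback.snd p f ≫ t)
    (by rw [hsq.w, Category.assoc])]
  exact (weakHomotopyEquivalence_of_anodyneExtensions
    ((KanFibration.of_isPullback hE' hp').anodyneExtensions_of_isPullback ht hs)).comp
    (TrivialFibration.of_isPullback hE'.flip hqt).homotopyEquivalence.weakHomotopyEquivalence

end Paper

/-- Right properness. The pullback of a weak homotopy equivalence
along a Kan fibration is a weak homotopy equivalence. -/
theorem right_properness {X Y B : SSet.{0}} (p : X ⟶ Y) (f : B ⟶ Y)
    (hp : Paper.KanFibration p) (hf : Paper.WeakHomotopyEquivalence f) :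
    Paper.WeakHomotopyEquivalence (pullback.fst p f) := by
  exact hp.weakHomotopyEquivalence_pullback_fst hf
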